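/- arXiv:math/0601476 — 2 statements merged into one kernel-verified Lean document; each statement's English description precedes it below -/
import Mathlib

section
/- For every natural number k ≥ 5, the fundamental group of the space A_k of oriented affine configurations of k distinct points in the real plane is isomorphic to the quotient of the fundamental group of the ordered configuration space F_k of k distinct points in ℝ² by its center. (Since π₁(F_k) is the pure braid group P_k whose center is the infinite cyclic group Z_k, this says π₁(A_k) ≅ P_k/Z_k.) -/
open Matrix

/-- The real plane, as `Fin 2 → ℝ`. -/
abbrev Plane : Type := Fin 2 → ℝ

/-- `F k`: the ordered configuration space of `k` distinct points in the plane. -/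
abbrev Conf (k : ℕ) : Type := {p : Fin k → Plane // Function.Injective p}

/-- `E k`: configurations of `k` distinct points affinely spanning the plane. -/
abbrev SpanConf (k : ℕ) : Type :=
  {p : Fin k → Plane // Function.Injective p ∧ affineSpan ℝ (Set.range p) = ⊤}

/-- The group `Aff₊(ℝ²)` of orientation preserving affine transformations `x ↦ A x + b`
(`A` a 2×2 real matrix with positive determinant, `b ∈ ℝ²`). -/
structure AffP : Type where
  A : Matrix (Fin 2) (Fin 2) ℝ
  b : Plane
  det_pos : 0 < A.det

/-- An affine transformation applied as a map of the plane, `x ↦ A x + b`. -/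
def AffP.app (g : AffP) (x : Plane) : Plane := g.A.mulVec x + g.b

/-- The orbit relation of the componentwise action of `Aff₊(ℝ²)` on `E k`. -/
def affRel (k : ℕ) (p q : SpanConf k) : Prop :=
  ∃ g : AffP, ∀ i : Fin k, g.app (p.1 i) = q.1 i

/-- `A k = E k / Aff₊(ℝ²)`: the space of oriented affine configurations of `k` distinct
points in the real plane, with the quotient topology. -/
abbrev AffConf (k : ℕ) : Type := Quot (affRel k)


open scoped unitInterval
namespace PBraid

theorem contr_I : ContractibleSpace I := by
  have : Convex ℝ (Set.Icc (0:ℝ) 1) := convex_Icc 0 1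
  exact this.contractibleSpace ⟨0, by simp⟩

/-- A torus map shows that two loops commute. -/
theorem square_comm {X : Type*} [TopologicalSpace X] {x : X} (Φ : C(I × I, X)) (u v : Path x x)
    (h0 : ∀ t, Φ (0, t) = u t) (h1 : ∀ t, Φ (1, t) = u t)
    (k0 : ∀ s, Φ (s, 0) = v s) (k1 : ∀ s, Φ (s, 1) = v s) :
    (u.trans v).Homotopic (v.trans u) := by
  have := contr_I
  let a : Path ((0 : I), (0 : I)) (0, 1) :=
    { toFun := fun t => (0, t), continuous_toFun := by fun_prop, source' := rfl, target' := rfl }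
  let b : Path ((0 : I), (1 : I)) (1, 1) :=
    { toFun := fun t => (t, 1), continuous_toFun := by fun_prop, source' := rfl, target' := rfl }
  let c : Path ((0 : I), (0 : I)) (1, 0) :=
    { toFun := fun t => (t, 0), continuous_toFun := by fun_prop, source' := rfl, target' := rfl }
  let d : Path ((1 : I), (0 : I)) (1, 1) :=
    { toFun := fun t => (1, t), continuous_toFun := by fun_prop, source' := rfl, target' := rfl }
  have H := (SimplyConnectedSpace.paths_homotopic (a.trans b) (c.trans d)).map Φ
  have e0 : x = Φ (0, 0) := by rw [h0]; simp
  have e1 : x = Φ (1, 1) := by rw [h1]; simp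
  have H2 := H.pathCast e0 e1
  have E1 : ((a.trans b).map Φ.continuous).cast e0 e1 = u.trans v := by
    ext t
    simp only [Path.cast_coe, Path.map_coe, Function.comp, Path.trans_apply]
    split_ifs
    · exact h0 _
    · exact k1 _
  have E2 : ((c.trans d).map Φ.continuous).cast e0 e1 = v.trans u := by
    ext t
    simp only [Path.cast_coe, Path.map_coe, Function.comp, Path.trans_apply]
    split_ifs
    · exact k0 _
    · exact h1 _
  rwa [E1, E2] at H2

/-- Class of a loop in the fundamental group. -/
def cls {X : Type*} [TopologicalSpace X] {x : X} (u : Path x x) : FundamentalGroup X x :=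
  Path.Homotopic.Quotient.mk u

theorem cls_surj {X : Type*} [TopologicalSpace X] {x : X} (z : FundamentalGroup X x) :
    ∃ u : Path x x, cls u = z := Path.Homotopic.Quotient.mk_surjective z

theorem cls_eq {X : Type*} [TopologicalSpace X] {x : X} {u v : Path x x} :
    cls u = cls v ↔ u.Homotopic v := Path.Homotopic.Quotient.eq

theorem cls_mul {X : Type*} [TopologicalSpace X] {x : X} (u v : Path x x) :
    cls u * cls v = cls (v.trans u) := rfl

theorem cls_refl {X : Type*} [TopologicalSpace X] {x : X} :
    cls (Path.refl x) = 1 := rfl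

theorem map_cls {X Y : Type*} [TopologicalSpace X] [TopologicalSpace Y] (f : C(X, Y)) {x : X}
    (u : Path x x) : FundamentalGroup.map f x (cls u) = cls (u.map f.continuous) := rfl

theorem cls_comm_of_square {X : Type*} [TopologicalSpace X] {x : X} (Φ : C(I × I, X))
    (u v : Path x x)
    (h0 : ∀ t, Φ (0, t) = u t) (h1 : ∀ t, Φ (1, t) = u t)
    (k0 : ∀ s, Φ (s, 0) = v s) (k1 : ∀ s, Φ (s, 1) = v s) :
    cls u * cls v = cls v * cls u := by
  rw [cls_mul, cls_mul, cls_eq]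
  exact (square_comm Φ u v h0 h1 k0 k1).symm

/-- The homomorphism to a product. -/
theorem map_prod_inj {A B : Type*} [TopologicalSpace A] [TopologicalSpace B] {a : A} {b : B}
    (z w : FundamentalGroup (A × B) (a, b))
    (h1 : FundamentalGroup.map (ContinuousMap.fst) (a, b) z =
      FundamentalGroup.map (ContinuousMap.fst) (a, b) w)
    (h2 : FundamentalGroup.map (ContinuousMap.snd) (a, b) z =
      FundamentalGroup.map (ContinuousMap.snd) (a, b) w) : z = w := by
  have := Path.Homotopic.prod_projLeft_projRight (p := z)
  rw [← this, ← Path.Homotopic.prod_projLeft_projRight (p := w)]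
  congr 1

/-- If `π₁ A` is commutative and `π₁ B` has trivial center, then `π₁ (A × B)` modulo its center
is `π₁ B`. -/
theorem prod_mod_center {A B : Type*} [TopologicalSpace A] [TopologicalSpace B] (a : A) (b : B)
    (hA : ∀ z w : FundamentalGroup A a, z * w = w * z)
    (hB : Subgroup.center (FundamentalGroup B b) = ⊥) :
    Nonempty (FundamentalGroup B b ≃* FundamentalGroup (A × B) (a, b) ⧸
      Subgroup.center (FundamentalGroup (A × B) (a, b))) := by
  let φ : FundamentalGroup (A × B) (a, b) →* FundamentalGroup B b :=
    FundamentalGroup.map (ContinuousMap.snd : C(A × B, B)) (a, b)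
  let φ' : FundamentalGroup (A × B) (a, b) →* FundamentalGroup A a :=
    FundamentalGroup.map (ContinuousMap.fst : C(A × B, A)) (a, b)
  have hs : Function.Surjective φ := by
    intro z
    obtain ⟨u, rfl⟩ := cls_surj z
    refine ⟨cls ((Path.refl a).prod u), ?_⟩
    change cls _ = cls _
    congr 1
  have hk : φ.ker = Subgroup.center (FundamentalGroup (A × B) (a, b)) := by
    ext z
    rw [MonoidHom.mem_ker, Subgroup.mem_center_iff]
    constructor
    · intro hz g
      apply map_prod_inj
      · change φ' _ = φ' _
        rw [map_mul, map_mul]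
        exact hA _ _
      · change φ _ = φ _
        rw [map_mul, map_mul, hz]
        simp
    · intro hz
      have : φ z ∈ Subgroup.center (FundamentalGroup B b) := by
        rw [Subgroup.mem_center_iff]
        intro g
        obtain ⟨g, rfl⟩ := hs g
        rw [← map_mul, hz, map_mul]
      rw [hB] at this
      exact this
  exact ⟨((QuotientGroup.quotientMulEquivOfEq hk).symm.trans
    (QuotientGroup.quotientKerEquivOfSurjective φ hs)).symm⟩

theorem quot_center_congr {G H : Type*} [Group G] [Group H] (e : G ≃* H) :
    Nonempty (G ⧸ Subgroup.center G ≃* H ⧸ Subgroup.center H) := by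
  refine ⟨QuotientGroup.congr _ _ e ?_⟩
  ext x
  simp only [Subgroup.mem_map, Subgroup.mem_center_iff]
  constructor
  · rintro ⟨y, hy, rfl⟩ g
    have := congrArg e (hy (e.symm g))
    simpa using this
  · intro h
    refine ⟨e.symm x, fun g => ?_, by simp⟩
    have := congrArg e.symm (h (e g))
    simpa using this

theorem center_bot_congr {G H : Type*} [Group G] [Group H] (e : G ≃* H)
    (h : Subgroup.center G = ⊥) : Subgroup.center H = ⊥ := by
  rw [eq_bot_iff]
  intro x hx
  rw [Subgroup.mem_center_iff] at hx
  have : e.symm x ∈ Subgroup.center G := by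
    rw [Subgroup.mem_center_iff]
    intro g
    have := congrArg e.symm (hx (e g))
    simpa using this
  rw [h, Subgroup.mem_bot] at this
  rw [Subgroup.mem_bot]
  simpa using this

/-- A homotopy equivalence with strict right inverse induces isomorphism of fundamental groups. -/
theorem pi1_equiv_of_retract {X Y : Type*} [TopologicalSpace X] [TopologicalSpace Y]
    (q : C(X, Y)) (r : C(Y, X)) (hqr : ∀ y, q (r y) = y) (H : (r.comp q).Homotopic (.id X)) (y : Y) :
    Nonempty (FundamentalGroup Y y ≃* FundamentalGroup X (r y)) := by
  let e : ContinuousMap.HomotopyEquiv Y X :=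
    ⟨r, q, by
      have : q.comp r = .id Y := by ext y; exact hqr y
      rw [this], H⟩
  let E := FundamentalGroupoidFunctor.equivOfHomotopyEquiv e
  let F := E.fullyFaithfulFunctor
  exact ⟨F.mulEquivEnd (FundamentalGroupoid.mk y)⟩

theorem pi1_homeo {X Y : Type*} [TopologicalSpace X] [TopologicalSpace Y] (h : X ≃ₜ Y) (y : Y) :
    Nonempty (FundamentalGroup Y y ≃* FundamentalGroup X (h.symm y)) := by
  apply pi1_equiv_of_retract (h : C(X, Y)) (h.symm : C(Y, X))
  · intro y; simp
  · have : (h.symm : C(Y, X)).comp (h : C(X, Y)) = .id X := by ext; simp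
    rw [this]

end PBraid

open scoped unitInterval
namespace PBraid

/-- Deterministic, stationary homotopy lifting over compact parameter spaces. -/
def HasTransport {E B : Type} [TopologicalSpace E] [TopologicalSpace B] (p : E → B) : Prop :=
  ∀ (Y : Type) [TopologicalSpace Y] [CompactSpace Y] (g : C(Y × I, B)) (f : C(Y, E)),
    (∀ y, p (f y) = g (y, 0)) → ∃ L : C(Y × I, E), (∀ y, L (y, 0) = f y) ∧
      (∀ y t, p (L (y, t)) = g (y, t)) ∧
      (∀ y y', f y = f y' → (∀ t, g (y, t) = g (y', t)) → ∀ t, L (y, t) = L (y', t)) ∧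
      (∀ y, (∀ t, g (y, t) = g (y, 0)) → ∀ t, L (y, t) = f y)

section transport
variable {E B : Type} [TopologicalSpace E] [TopologicalSpace B]

theorem transport_surj (p : C(E, B)) (hT : HasTransport p) (e : E)
    [PathConnectedSpace {x : E // p x = p e}] :
    Function.Surjective (FundamentalGroup.map p e) := by
  intro z
  obtain ⟨β, rfl⟩ := cls_surj z
  obtain ⟨L, L0, Lp, -, -⟩ := hT PUnit ⟨fun y => β y.2, by fun_prop⟩ ⟨fun _ => e, by fun_prop⟩
    (by simp)
  have hL1 : p (L (PUnit.unit, 1)) = p e := by rw [Lp]; simp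
  let η : Path (⟨L (PUnit.unit, 1), hL1⟩ : {x : E // p x = p e}) ⟨e, rfl⟩ :=
    PathConnectedSpace.somePath _ _
  let η' : Path (L (PUnit.unit, 1)) e := η.map continuous_subtype_val
  let l : Path e (L (PUnit.unit, 1)) :=
    { toFun := fun t => L (PUnit.unit, t), continuous_toFun := by fun_prop
      source' := L0 _, target' := rfl }
  refine ⟨cls (l.trans η'), ?_⟩
  rw [map_cls, cls_eq]
  have h1 : ((l.trans η').map p.continuous) = β.trans (Path.refl _) := by
    ext t
    simp only [Path.map_coe, Function.comp, Path.trans_apply]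
    split_ifs
    · exact Lp _ _
    · exact (η _).2
  rw [h1]
  exact ⟨Path.Homotopy.transRefl β⟩

theorem transport_ker (p : C(E, B)) (hT : HasTransport p) (e : E)
    (z : FundamentalGroup E e) (hz : FundamentalGroup.map p e z = 1) :
    ∃ w : Path (⟨e, rfl⟩ : {x : E // p x = p e}) ⟨e, rfl⟩,
      z = cls (w.map continuous_subtype_val) := by
  obtain ⟨γ, rfl⟩ := cls_surj z
  rw [map_cls, ← cls_refl, cls_eq] at hz
  obtain ⟨H⟩ := hz
  obtain ⟨L, L0, Lp, -, Ls⟩ := hT I ⟨fun y => H (y.2, y.1), by fun_prop⟩ ⟨fun y => γ y, by fun_prop⟩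
    (by simp)
  have s0 : ∀ t, L (0, t) = e := by
    intro t
    rw [Ls 0 (by simp)]; simp
  have s1 : ∀ t, L (1, t) = e := by
    intro t
    rw [Ls 1 (by simp)]; simp
  let w : Path (⟨e, rfl⟩ : {x : E // p x = p e}) ⟨e, rfl⟩ :=
    { toFun := fun s => ⟨L (s, 1), by rw [Lp]; simp⟩
      continuous_toFun := by fun_prop
      source' := Subtype.ext (s0 _)
      target' := Subtype.ext (s1 _) }
  refine ⟨w, ?_⟩
  rw [cls_eq]
  exact ⟨{ toFun := fun x => L (x.2, x.1)
           continuous_toFun := by fun_prop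
           map_zero_left := fun s => by simp [L0]
           map_one_left := fun s => by rfl
           prop' := by
            intro t x hx
            rcases hx with rfl | hx
            · simp [s0]
            · rw [Set.mem_singleton_iff.1 hx]; simp [s1] }⟩

theorem transport_central (p : C(E, B)) (hT : HasTransport p) (e : E)
    (w u : Path (⟨e, rfl⟩ : {x : E // p x = p e}) ⟨e, rfl⟩)
    (hw : cls (w.map continuous_subtype_val) = 1) : cls u * cls w = cls w * cls u := by
  rw [← cls_refl, cls_eq] at hw
  obtain ⟨H⟩ := hw
  let f : C((I × I) ⊕ (I × I), E) :=
    ⟨Sum.elim (fun x => (u x.2 : E)) (fun x => H (x.2, x.1)), by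
      apply Continuous.sumElim <;> fun_prop⟩
  let g0 : (I × I) ⊕ (I × I) → I → I × I :=
    fun y τ => Sum.elim (fun x => (σ τ, x.1)) (fun x => (σ τ * x.2, x.1)) y
  have hg0 : Continuous (fun q : ((I × I) ⊕ (I × I)) × I => g0 q.1 q.2) := by
    have : Continuous (fun q : I × ((I × I) ⊕ (I × I)) => g0 q.2 q.1) := by
      have h2 : Continuous (Sum.elim (fun q : I × (I × I) => (σ q.1, q.2.1))
        (fun q : I × (I × I) => (σ q.1 * q.2.2, q.2.1))) := by
        apply Continuous.sumElim <;> fun_prop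
      convert h2.comp (Homeomorph.prodSumDistrib (X := I) (Y := I × I) (Z := I × I)).continuous using 1
      ext ⟨τ, (x | x)⟩ <;> rfl
    exact this.comp (Homeomorph.prodComm _ _).continuous
  obtain ⟨L, L0, Lp, Ld, Ls⟩ := hT ((I × I) ⊕ (I × I))
    ⟨fun y => p (H (g0 y.1 y.2)), by fun_prop⟩ f (by
      rintro (y | y)
      · simpa [f, g0] using (u y.2).2
      · simp [f, g0])
  have pw : ∀ s, p (H (0, s)) = p e := fun s => by simpa using (w s).2
  have c0 : ∀ t τ, L (Sum.inl (0, t), τ) = u t := fun t τ => by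
    rw [Ls (Sum.inl (0, t))]
    · rfl
    · simp [g0]
  have c1 : ∀ t τ, L (Sum.inl (1, t), τ) = u t := fun t τ => by
    rw [Ls (Sum.inl (1, t))]
    · rfl
    · simp [g0]
  have hΦ : ∀ s t, p (L (Sum.inl (s, t), 1)) = p e := fun s t => by
    rw [Lp]; simpa [g0] using (w s).2
  have hK : ∀ s t, p (L (Sum.inr (s, t), 1)) = p e := fun s t => by
    rw [Lp]; simpa [g0] using (w s).2
  let Φ : C(I × I, {x : E // p x = p e}) :=
    ⟨fun x => ⟨L (Sum.inl (x.1, x.2), 1), hΦ _ _⟩, by fun_prop⟩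
  let v : Path (⟨e, rfl⟩ : {x : E // p x = p e}) ⟨e, rfl⟩ :=
    { toFun := fun s => Φ (s, 0)
      continuous_toFun := by fun_prop
      source' := Subtype.ext (by simp [Φ, c0])
      target' := Subtype.ext (by simp [Φ, c1]) }
  have huv : cls u * cls v = cls v * cls u := by
    apply cls_comm_of_square Φ
    · exact fun t => Subtype.ext (c0 _ _)
    · exact fun t => Subtype.ext (c1 _ _)
    · exact fun t => rfl
    · intro s
      apply Subtype.ext
      apply Ld
      · simp [f]
      · intro t; simp [g0]
  have hwv : cls w = cls v := by
    rw [cls_eq]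
    refine ⟨{ toFun := fun x => ⟨L (Sum.inr (x.2, x.1), 1), hK _ _⟩
              continuous_toFun := by fun_prop
              map_zero_left := fun s => Subtype.ext ?_
              map_one_left := fun s => Subtype.ext ?_
              prop' := ?_ }⟩
    · change L (Sum.inr (s, 0), 1) = (w s : E)
      rw [Ls]
      · simp [f]
      · simp [g0]
    · change L (Sum.inr (s, 1), 1) = L (Sum.inl (s, 0), 1)
      apply Ld
      · simp [f]
      · intro t; simp [g0]
    · intro t x hx
      apply Subtype.ext
      rcases hx with rfl | hx
      · change L (Sum.inr (0, t), 1) = (w 0 : E)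
        rw [Ls]
        · simp [f]
        · simp [g0]
      · rw [Set.mem_singleton_iff.1 hx]
        change L (Sum.inr (1, t), 1) = (w 1 : E)
        rw [Ls]
        · simp [f]
        · simp [g0]
  rw [hwv, huv]

theorem center_of_transport (p : C(E, B)) (hT : HasTransport p) (e : E)
    [PathConnectedSpace {x : E // p x = p e}]
    (hB : Subgroup.center (FundamentalGroup B (p e)) = ⊥)
    (hF : Subgroup.center (FundamentalGroup {x : E // p x = p e} ⟨e, rfl⟩) = ⊥) :
    Subgroup.center (FundamentalGroup E e) = ⊥ := by
  rw [eq_bot_iff]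
  intro z hz
  rw [Subgroup.mem_center_iff] at hz
  rw [Subgroup.mem_bot]
  have h1 : FundamentalGroup.map p e z ∈ Subgroup.center (FundamentalGroup B (p e)) := by
    rw [Subgroup.mem_center_iff]
    intro g
    obtain ⟨g, rfl⟩ := transport_surj p hT e g
    rw [← map_mul, hz, map_mul]
  rw [hB, Subgroup.mem_bot] at h1
  obtain ⟨w, rfl⟩ := transport_ker p hT e z h1
  let i : FundamentalGroup {x : E // p x = p e} ⟨e, rfl⟩ →* FundamentalGroup E e :=
    FundamentalGroup.map (⟨Subtype.val, continuous_subtype_val⟩ : C({x : E // p x = p e}, E)) _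
  have hi : ∀ w, i (cls w) = cls (w.map continuous_subtype_val) := fun _ => rfl
  have hker : ∀ a, i a = 1 → a = 1 := by
    intro a ha
    obtain ⟨a, rfl⟩ := cls_surj a
    have : cls a ∈ Subgroup.center (FundamentalGroup {x : E // p x = p e} ⟨e, rfl⟩) := by
      rw [Subgroup.mem_center_iff]
      intro g
      obtain ⟨g, rfl⟩ := cls_surj g
      exact transport_central p hT e a g ha
    rwa [hF, Subgroup.mem_bot] at this
  have hinj : Function.Injective i := (injective_iff_map_eq_one i).2 hker
  have : cls w ∈ Subgroup.center (FundamentalGroup {x : E // p x = p e} ⟨e, rfl⟩) := by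
    rw [Subgroup.mem_center_iff]
    intro g
    apply hinj
    rw [map_mul, map_mul, hi, hz]
  rw [hF, Subgroup.mem_bot] at this
  rw [← hi, this, map_one]

theorem pathConnected_of_transport (p : C(E, B)) (hT : HasTransport p) [PathConnectedSpace B]
    (hE : Nonempty E) (hF : ∀ e, PathConnectedSpace {x : E // p x = p e}) :
    PathConnectedSpace E := by
  refine ⟨hE, fun x y => ?_⟩
  let β := PathConnectedSpace.somePath (p x) (p y)
  obtain ⟨L, L0, Lp, -, -⟩ := hT PUnit ⟨fun y => β y.2, by fun_prop⟩ ⟨fun _ => x, by fun_prop⟩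
    (by simp)
  have hL1 : p (L (PUnit.unit, 1)) = p y := by rw [Lp]; simp
  have := hF y
  let η : Path (⟨L (PUnit.unit, 1), hL1⟩ : {x : E // p x = p y}) ⟨y, rfl⟩ :=
    PathConnectedSpace.somePath _ _
  let η' : Path (L (PUnit.unit, 1)) y := η.map continuous_subtype_val
  let l : Path x (L (PUnit.unit, 1)) :=
    { toFun := fun t => L (PUnit.unit, t), continuous_toFun := by fun_prop
      source' := L0 _, target' := rfl }
  exact ⟨l.trans η'⟩

end transport

/-- A local connection gives transport. -/
theorem hasTransport_of_slide {E B : Type} [TopologicalSpace E] [MetricSpace B]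
    (p : C(E, B)) (δ : C(B, ℝ)) (hδ : ∀ b, 0 < δ b)
    (S : C({x : E × B // dist (p x.1) x.2 < δ (p x.1)}, E))
    (hS : ∀ x, p (S x) = x.1.2) (hS0 : ∀ x, p x.1.1 = x.1.2 → S x = x.1.1) :
    HasTransport p := by
  intro Y _ _ g f hfg
  -- uniform lower bound
  obtain ⟨ε, hε, hεδ⟩ : ∃ ε > 0, ∀ x, ε ≤ δ (g x) := by
    rcases isEmpty_or_nonempty (Y × I) with h | h
    · exact ⟨1, one_pos, fun x => h.elim x⟩
    · obtain ⟨x, -, hx⟩ := isCompact_univ.exists_isMinOn (Set.univ_nonempty (α := Y × I))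
        (f := fun x => δ (g x)) (by fun_prop)
      exact ⟨δ (g x), hδ _, fun y => hx (Set.mem_univ y)⟩
  -- uniform continuity in time
  let G : C(I, C(Y, B)) := ContinuousMap.curry ⟨fun x : I × Y => g (x.2, x.1), by fun_prop⟩
  have hG : UniformContinuous G := CompactSpace.uniformContinuous_of_continuous G.continuous
  obtain ⟨η, hη, hηG⟩ := Metric.uniformContinuous_iff.1 hG ε hε
  have hclose : ∀ y (s t : I), dist s t < η → dist (g (y, s)) (g (y, t)) < ε := by
    intro y s t hst
    exact lt_of_le_of_lt (ContinuousMap.dist_apply_le_dist (f := G s) (g := G t) y) (hηG hst)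
  obtain ⟨N, hN⟩ := exists_nat_gt (1 / η)
  have hN0 : (0 : ℝ) < N := lt_trans (by positivity) hN
  let τ : ℕ → I := fun j => Set.projIcc 0 1 zero_le_one ((j : ℝ) / N)
  have hτ : ∀ j, dist (τ j) (τ (j + 1)) < η := by
    intro j
    refine lt_of_le_of_lt ((LipschitzWith.projIcc zero_le_one).dist_le_mul _ _) ?_
    rw [Real.dist_eq]
    have : (j : ℝ) / N - ((j + 1 : ℕ) : ℝ) / N = - (1 / N) := by push_cast; ring
    rw [this, abs_neg, abs_of_pos (by positivity)]
    simp only [NNReal.coe_one, one_mul]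
    rw [div_lt_comm₀ hN0 hη]; exact hN
  have hτm : ∀ j (t : I), dist (min t (τ j)) (min t (τ (j + 1))) < η := by
    intro j t
    refine lt_of_le_of_lt ?_ (hτ j)
    simp only [Subtype.dist_eq, Real.dist_eq]
    have := abs_min_sub_min_le_max (t : ℝ) (τ j) t (τ (j + 1))
    simpa using this
  have hτ0 : τ 0 = 0 := by simp [τ]
  have hτN : τ N = 1 := by simp [τ, hN0.ne']
  have key : ∀ j : ℕ, ∃ L : C(Y × I, E), (∀ y, L (y, 0) = f y) ∧
      (∀ y t, p (L (y, t)) = g (y, min t (τ j))) ∧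
      (∀ y y', f y = f y' → (∀ t, g (y, t) = g (y', t)) → ∀ t, L (y, t) = L (y', t)) ∧
      (∀ y, (∀ t, g (y, t) = g (y, 0)) → ∀ t, L (y, t) = f y) := by
    intro j
    induction j with
    | zero =>
      refine ⟨⟨fun x => f x.1, by fun_prop⟩, fun y => rfl, fun y t => ?_, fun y y' h _ t => h,
        fun y _ t => rfl⟩
      simp only [ContinuousMap.coe_mk, hfg, hτ0]
      congr 2
      exact (min_eq_right unitInterval.nonneg').symm
    | succ j ih =>
      obtain ⟨L, L0, Lp, Ld, Ls⟩ := ih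
      have hmem : ∀ x : Y × I, dist (p (L x)) (g (x.1, min x.2 (τ (j + 1)))) < δ (p (L x)) := by
        intro x
        obtain ⟨y, t⟩ := x
        rw [Lp]
        exact lt_of_lt_of_le (hclose _ _ _ (hτm j t)) (hεδ _)
      let L' : C(Y × I, E) := S.comp
        ⟨fun x => ⟨(L x, g (x.1, min x.2 (τ (j + 1)))), hmem x⟩, by fun_prop⟩
      have hL' : ∀ x, L' x = S ⟨(L x, g (x.1, min x.2 (τ (j + 1)))), hmem x⟩ := fun x => rfl
      refine ⟨L', fun y => ?_, fun y t => ?_, ?_, ?_⟩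
      · rw [hL', hS0]
        · exact L0 y
        · simp only [Lp]
          congr 2
          rw [min_eq_left unitInterval.nonneg', min_eq_left unitInterval.nonneg']
      · rw [hL', hS]
      · intro y y' h1 h2 t
        rw [hL', hL']
        congr 3
        · exact Ld y y' h1 h2 t
        · exact h2 _
      · intro y h t
        rw [hL', hS0]
        · exact Ls y h t
        · simp only [Lp]
          rw [h, h (min t (τ (j + 1)))]
  obtain ⟨L, L0, Lp, Ld, Ls⟩ := key N
  refine ⟨L, L0, fun y t => ?_, Ld, Ls⟩
  rw [Lp, hτN]
  congr 2
  exact min_eq_left unitInterval.le_one'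

end PBraid

open scoped unitInterval
namespace PBraid

theorem freeGroup_center_bot {J : Type*} [Nontrivial J] :
    Subgroup.center (FreeGroup J) = ⊥ := by
  classical
  rw [Subgroup.eq_bot_iff_forall]
  intro z hz
  rw [Subgroup.mem_center_iff] at hz
  by_contra hne
  have hw : z.toWord ≠ [] := by simpa [FreeGroup.toWord_eq_nil_iff] using hne
  obtain ⟨⟨x, b⟩, L, hL⟩ := List.exists_cons_of_ne_nil hw
  obtain ⟨y, hy⟩ := exists_ne x
  have hr : FreeGroup.IsReduced z.toWord := FreeGroup.isReduced_toWord
  have h1 : (FreeGroup.of y * z).toWord = (y, true) :: z.toWord := by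
    rw [FreeGroup.toWord_mul, FreeGroup.toWord_of]
    apply FreeGroup.IsReduced.reduce_eq
    rw [hL] at hr ⊢
    simp only [List.cons_append, List.nil_append, FreeGroup.isReduced_cons_cons]
    exact ⟨fun h => absurd h hy, hr⟩
  have h2 : (FreeGroup.of y * z).toWord.length = (z * FreeGroup.of y).toWord.length := by
    rw [hz]
  have h3 : (z * FreeGroup.of y).toWord = z.toWord ++ [(y, true)] := by
    have hs := FreeGroup.toWord_mul_sublist z (FreeGroup.of y)
    rw [FreeGroup.toWord_of] at hs
    apply hs.eq_of_length
    rw [← h2, h1]; simp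
  rw [← hz, h1, hL] at h3
  simp at h3
  exact hy h3.1.1

theorem homotopic_of_mem {X : Type*} [TopologicalSpace X] {A : Set X} (hA : IsSimplyConnected A)
    {x y : X} (γ δ : Path x y) (hγ : ∀ t, γ t ∈ A) (hδ : ∀ t, δ t ∈ A) : γ.Homotopic δ := by
  have := hA.simplyConnectedSpace
  have hx : x ∈ A := by simpa using hγ 0
  have hy : y ∈ A := by simpa using hγ 1
  let γ' : Path (⟨x, hx⟩ : A) ⟨y, hy⟩ :=
    { toFun := fun t => ⟨γ t, hγ t⟩, continuous_toFun := by fun_prop,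
      source' := by simp, target' := by simp }
  let δ' : Path (⟨x, hx⟩ : A) ⟨y, hy⟩ :=
    { toFun := fun t => ⟨δ t, hδ t⟩, continuous_toFun := by fun_prop,
      source' := by simp, target' := by simp }
  exact (SimplyConnectedSpace.paths_homotopic γ' δ').map ⟨Subtype.val, continuous_subtype_val⟩


theorem vk_gen {X : Type*} [TopologicalSpace X] (W : Bool → Set X) (hW : ∀ b, IsOpen (W b))
    (hc : ∀ x, ∃ b, x ∈ W b) (hs : ∀ b, IsSimplyConnected (W b)) (x0 : X) 
    (α : ∀ (_ : Bool) (x : X), Path x0 x) (hα : ∀ b, ∀ x ∈ W b, ∀ t, α b x t ∈ W b)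
    (h0 : ∀ b, x0 ∈ W b)
    (R : Subgroup (FundamentalGroup X x0)) 
    (hR : ∀ x, x ∈ W true → x ∈ W false → cls ((α true x).trans (α false x).symm) ∈ R) :
    R = ⊤ := by
  have hR' : ∀ b b' x, x ∈ W b → x ∈ W b' → cls ((α b x).trans (α b' x).symm) ∈ R := by
    have h1 : ∀ b x, cls ((α b x).trans (α b x).symm) ∈ R := by
      intro b x
      have : cls ((α b x).trans (α b x).symm) = 1 := by
        rw [← cls_refl, cls_eq]; exact ⟨(Path.Homotopy.reflTransSymm _).symm⟩
      rw [this]; exact R.one_mem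
    intro b b' x hx hx'
    cases b <;> cases b'
    · exact h1 _ _
    · have := R.inv_mem (hR x hx' hx)
      have e : (cls ((α true x).trans (α false x).symm))⁻¹ = 
        cls (((α true x).trans (α false x).symm).symm) := rfl
      rw [e, Path.trans_symm, Path.symm_symm] at this
      exact this
    · exact hR x hx hx'
    · exact h1 _ _
  have key : ∀ {x y : X} (b : Bool) (γ : Path x y), (∀ t, γ t ∈ W b) → 
      (Path.Homotopic.Quotient.mk (α b x)).trans (Path.Homotopic.Quotient.mk γ) = Path.Homotopic.Quotient.mk (α b y) := by
    intro x y b γ h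
    have hx : x ∈ W b := by simpa using h 0
    have hy : y ∈ W b := by simpa using h 1
    rw [← Path.Homotopic.Quotient.mk_trans]
    apply Path.Homotopic.Quotient.eq.2
    apply homotopic_of_mem (hs b)
    · intro t
      rw [Path.trans_apply]
      split_ifs
      · exact hα _ _ hx _
      · exact h _
    · exact hα _ _ hy
  rw [eq_top_iff]
  rintro z -
  obtain ⟨γ, rfl⟩ := cls_surj z
  obtain ⟨t, ht0, htm, ⟨N, hN⟩, htc⟩ := exists_monotone_Icc_subset_open_cover_unitInterval
    (c := fun b => γ ⁻¹' W b) (fun b => (hW b).preimage γ.continuous) 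
    (fun s _ => by obtain ⟨b, hb⟩ := hc (γ s); exact Set.mem_iUnion.2 ⟨b, hb⟩)
  have main : ∀ n, ∀ b, γ (t n) ∈ W b → 
      cls (((γ.subpath 0 (t n)).cast γ.source.symm rfl).trans (α b (γ (t n))).symm) ∈ R := by
    intro n
    induction n with
    | zero =>
      intro b hb
      have : cls (((γ.subpath 0 (t 0)).cast γ.source.symm rfl).trans (α b (γ (t 0))).symm) = 1 := by
        rw [← cls_refl, cls_eq]
        apply homotopic_of_mem (hs b)
        · intro s
          rw [Path.trans_apply]
          split_ifs
          · have : ∀ u, γ (Set.Icc.convexComb 0 (t 0) u) = x0 := by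
              intro u; rw [ht0]; 
              rw [Set.Icc.convexComb_eq]; simp
            simp only [Path.cast_coe, Path.subpath]
            simp [this, h0]
          · exact hα _ _ hb _
        · intro s; exact h0 b
      rw [this]; exact R.one_mem
    | succ n ih =>
      intro b hb
      obtain ⟨c, hcn⟩ := htc n
      have e1 : γ (t n) ∈ W c := hcn ⟨le_rfl, htm n.le_succ⟩
      have e2 : γ (t (n+1)) ∈ W c := hcn ⟨htm n.le_succ, le_rfl⟩
      have e3 : ∀ s, γ.subpath (t n) (t (n+1)) s ∈ W c := by
        intro s
        have : γ.subpath (t n) (t (n+1)) s ∈ Set.range (γ.subpath (t n) (t (n+1))) := ⟨s, rfl⟩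
        rw [Path.range_subpath_of_le _ _ _ (htm n.le_succ)] at this
        obtain ⟨u, hu, hu'⟩ := this
        rw [← hu']; exact hcn hu
      have k := key c _ e3
      have i1 := ih c e1
      have i2 := hR' c b _ e2 hb
      have i3 := R.mul_mem i2 i1
      rw [cls_mul] at i3
      convert i3 using 1
      have hsub : Path.Homotopic.Quotient.mk ((γ.subpath 0 (t (n+1))).cast γ.source.symm rfl) = 
        (Path.Homotopic.Quotient.mk ((γ.subpath 0 (t n)).cast γ.source.symm rfl)).trans 
          (Path.Homotopic.Quotient.mk (γ.subpath (t n) (t (n+1)))) := by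
        rw [← Path.Homotopic.Quotient.mk_trans]
        apply Path.Homotopic.Quotient.eq.2
        symm
        exact (Path.Homotopic.pathCast ⟨Path.Homotopy.subpathTransSubpath γ 0 (t n) (t (n+1))⟩ γ.source.symm rfl)
      unfold cls
      simp only [Path.Homotopic.Quotient.mk_trans, hsub, Path.Homotopic.Quotient.mk_symm]
      simp only [← k, Path.Homotopic.Quotient.trans_assoc]
      congr 1
      rw [← Path.Homotopic.Quotient.trans_assoc (Path.Homotopic.Quotient.symm _), Path.Homotopic.Quotient.symm_trans, Path.Homotopic.Quotient.refl_trans]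
  have hm := main N true (by rw [hN N le_rfl]; simpa using h0 true)
  have fin : ∀ s : I, s = 1 → cls (((γ.subpath 0 s).cast γ.source.symm rfl).trans (α true (γ s)).symm) ∈ R 
      → cls γ ∈ R := by
    rintro s rfl h
    have : cls (((γ.subpath 0 1).cast γ.source.symm rfl).trans (α true (γ 1)).symm) = 
        cls (γ.trans (α true x0).symm) := by
      congr 1
      ext s
      rw [Path.trans_apply, Path.trans_apply]
      split_ifs
      · simp
      · simp only [Path.symm_apply]
        rw [γ.target]
    rw [this] at h
    have h3 : (α true x0).symm.Homotopic (Path.refl x0) := by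
      apply homotopic_of_mem (hs true)
      · intro t; exact hα true x0 (h0 true) _
      · intro t; exact h0 true
    have h4 : cls (γ.trans (α true x0).symm) = cls γ := by
      have : cls (α true x0).symm = 1 := by rw [← cls_refl, cls_eq]; exact h3
      rw [← cls_mul, this, one_mul]
    rwa [h4] at h
  exact fin _ (hN N le_rfl) hm

end PBraid

open scoped unitInterval Topology
namespace PBraid

/-- transition function -/
def trFun {G X : Type*} [Group G] (c : X → G) : Bool → Bool → X → G → G
  | true, true, _, g => g
  | false, false, _, g => g
  | true, false, x, g => c x * g
  | false, true, x, g => (c x)⁻¹ * g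

theorem vk_cover {X G : Type} [TopologicalSpace X] [Group G] (W : Bool → Set X)
    (hW : ∀ b, IsOpen (W b)) (hc : ∀ x, ∃ b, x ∈ W b) (c : X → G)
    (hl : ∀ x, x ∈ W true → x ∈ W false → ∀ᶠ y in 𝓝 x, c y = c x) :
    ∃ (E : Type) (_ : TopologicalSpace E) (p : E → X) (_ : IsCoveringMap p)
      (sec : Bool → G → X → E), (∀ b g x, p (sec b g x) = x) ∧
      (∀ b g, ContinuousOn (sec b g) (W b)) ∧
      (∀ b x, x ∈ W b → Function.Injective (fun g => sec b g x)) ∧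
      (∀ g x, x ∈ W true → x ∈ W false → sec true g x = sec false (c x * g) x) := by
  choose ix hix using hc
  let _ : TopologicalSpace G := ⊥
  have : DiscreteTopology G := ⟨rfl⟩
  have hcont : ∀ (f : G → G → G) (S : Set X), (∀ x ∈ S, x ∈ W true ∧ x ∈ W false) → 
      ContinuousOn (fun p : X × G => f (c p.1) p.2) (S ×ˢ Set.univ) := by
    rintro f S hS ⟨x, g⟩ ⟨hx, -⟩
    apply ContinuousAt.continuousWithinAt
    have h1 := hl x (hS x hx).1 (hS x hx).2
    have : (fun p : X × G => f (c p.1) p.2) =ᶠ[𝓝 (x, g)] fun p => f (c x) p.2 := by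
      have h2 : ∀ᶠ p : X × G in 𝓝 (x, g), c p.1 = c x := (continuous_fst.tendsto (x, g)).eventually h1
      filter_upwards [h2] with p hp
      rw [hp]
    refine ContinuousAt.congr ?_ this.symm
    exact (continuous_of_discreteTopology (f := f (c x))).continuousAt.comp continuous_snd.continuousAt
  let Z : FiberBundleCore Bool X G :=
    { baseSet := W
      isOpen_baseSet := hW
      indexAt := ix
      mem_baseSet_at := hix
      coordChange := trFun c
      coordChange_self := by
        intro i x _ v
        cases i <;> rfl
      continuousOn_coordChange := by
        intro i j
        cases i <;> cases j
        · exact continuousOn_snd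
        · exact hcont (fun a b => a⁻¹ * b) _ (fun x hx => ⟨hx.2, hx.1⟩)
        · exact hcont (fun a b => a * b) _ (fun x hx => ⟨hx.1, hx.2⟩)
        · exact continuousOn_snd
      coordChange_comp := by
        intro i j k x _ v
        cases i <;> cases j <;> cases k <;> simp [trFun] }
  refine ⟨Z.TotalSpace, inferInstance, Z.proj, 
    IsFiberBundle.isCoveringMap (fun x => ⟨Z.localTriv (ix x), hix x⟩),
    fun b g x => (Z.localTriv b).toOpenPartialHomeomorph.symm (x, g), ?_, ?_, ?_, ?_⟩
  · intro b g x; rfl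
  · intro b g
    refine (Z.localTriv b).toOpenPartialHomeomorph.continuousOn_symm.comp 
      (f := fun x => (x, g)) (by fun_prop) ?_
    intro x hx
    exact ⟨hx, trivial⟩
  · intro b x hx g g' h
    have := (Z.localTriv b).toOpenPartialHomeomorph.symm.injOn (x₁ := (x, g)) (x₂ := (x, g'))
      ⟨hx, trivial⟩ ⟨hx, trivial⟩ h
    simpa using this
  · intro g x h1 h2
    have : trFun c true (ix x) x g = trFun c false (ix x) x (c x * g) := by
      cases ix x <;> simp [trFun]
    exact congrArg (Bundle.TotalSpace.mk' G x) this

theorem vk_mon {X G : Type} [TopologicalSpace X] [Group G] (W : Bool → Set X)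
    (hW : ∀ b, IsOpen (W b)) (hc : ∀ x, ∃ b, x ∈ W b) (c : X → G)
    (hl : ∀ x, x ∈ W true → x ∈ W false → ∀ᶠ y in 𝓝 x, c y = c x) (x0 : X) 
    (h0 : ∀ b, x0 ∈ W b) (hc0 : c x0 = 1) : 
    ∃ (F : Type) (m : FundamentalGroup X x0 →* Equiv.Perm F) (ι : G → F), Function.Injective ι ∧
      ∀ (x : X) (α β : Path x0 x), (∀ t, α t ∈ W true) → (∀ t, β t ∈ W false) → ∀ g,
        m (cls (α.trans β.symm)) (ι g) = ι (c x * g) := by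
  obtain ⟨E, _, p, cov, sec, hp, hcont, hinj, hsec⟩ := vk_cover W hW hc c hl
  refine ⟨p ⁻¹' {x0}, cov.monodromyPerm x0, fun g => ⟨sec true g x0, hp _ _ _⟩, ?_, ?_⟩
  · intro g g' h
    exact hinj true x0 (h0 _) (congrArg Subtype.val h)
  · intro x α β hα hβ g
    have key : ∀ (b : Bool) {x y : X} (γ : Path x y) (_ : ∀ t, γ t ∈ W b) (g : G),
        cov.monodromy (Path.Homotopic.Quotient.mk γ) ⟨sec b g x, hp _ _ _⟩ = ⟨sec b g y, hp _ _ _⟩ := by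
      intro b x y γ hγ g
      let Γ : Path (sec b g x) (sec b g y) := 
        { toFun := fun t => sec b g (γ t)
          continuous_toFun := (hcont b g).comp_continuous γ.continuous hγ
          source' := by simp
          target' := by simp }
      refine cov.monodromy_eq_of_map_eq (Path.Homotopic.Quotient.mk Γ) ?_
      change Path.Homotopic.Quotient.mk (Γ.map cov.continuous) = Path.Homotopic.Quotient.mk (γ.cast _ _)
      congr 1
      ext t
      exact hp _ _ _
    rw [IsCoveringMap.coe_monodromyPerm]
    change cov.monodromy (Path.Homotopic.Quotient.mk (α.trans β.symm)) _ = _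
    rw [Path.Homotopic.Quotient.mk_trans, cov.monodromy_trans_apply, key true α hα g]
    have hx1 : x ∈ W true := by simpa using hα 1
    have hx2 : x ∈ W false := by simpa using hβ 1
    have e : (⟨sec true g x, hp _ _ _⟩ : p ⁻¹' {x}) = ⟨sec false (c x * g) x, hp _ _ _⟩ :=
      Subtype.ext (hsec g x hx1 hx2)
    have e0 : (⟨sec true (c x * g) x0, hp _ _ _⟩ : p ⁻¹' {x0}) = ⟨sec false (c x * g) x0, hp _ _ _⟩ :=
      Subtype.ext ((hsec _ x0 (h0 _) (h0 _)).trans (by rw [hc0, one_mul]))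
    rw [e]
    exact (key false β.symm (fun t => hβ _) _).trans e0.symm

theorem vk_center {X : Type} [TopologicalSpace X] [LocallyPathConnectedSpace X] (W : Bool → Set X)
    (hW : ∀ b, IsOpen (W b)) (hc : ∀ x, ∃ b, x ∈ W b) (hs : ∀ b, IsSimplyConnected (W b)) 
    (x0 y1 y2 : X) (h0 : ∀ b, x0 ∈ W b) (h1 : ∀ b, y1 ∈ W b) (h2 : ∀ b, y2 ∈ W b)
    (n1 : ¬ JoinedIn (W true ∩ W false) x0 y1) (n2 : ¬ JoinedIn (W true ∩ W false) x0 y2)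
    (n3 : ¬ JoinedIn (W true ∩ W false) y1 y2) :
    Subgroup.center (FundamentalGroup X x0) = ⊥ := by
  classical
  let V := W true ∩ W false
  let J : Type := {A : Set X // ∃ y ∈ V, ¬ JoinedIn V x0 y ∧ pathComponentIn V y = A}
  choose rep hrV hrN hrA using (fun j : J => j.2)
  have hnt : Nontrivial J := by
    refine ⟨⟨_, y1, ⟨h1 _, h1 _⟩, n1, rfl⟩, ⟨_, y2, ⟨h2 _, h2 _⟩, n2, rfl⟩, ?_⟩
    intro h
    have h' : pathComponentIn V y1 = pathComponentIn V y2 := congrArg Subtype.val h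
    have : y2 ∈ pathComponentIn V y1 := by
      rw [h']; exact mem_pathComponentIn_self ⟨h2 _, h2 _⟩
    exact n3 this
  let c : X → FreeGroup J := fun x => 
    if h : x ∈ V ∧ ¬ JoinedIn V x0 x then .of ⟨pathComponentIn V x, x, h.1, h.2, rfl⟩ else 1
  have hcr : ∀ j, c (rep j) = .of j := by
    intro j
    have : rep j ∈ V ∧ ¬ JoinedIn V x0 (rep j) := ⟨hrV j, hrN j⟩
    simp only [c, this]
    simp [hrA]
  have hx0V : x0 ∈ V := ⟨h0 _, h0 _⟩
  have hc0 : c x0 = 1 := by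
    have : JoinedIn V x0 x0 := JoinedIn.refl hx0V
    simp [c, this]
  have hcj : ∀ x y, JoinedIn V x y → c x = c y := by
    intro x y h
    have hx := h.source_mem
    have hy := h.target_mem
    have e : pathComponentIn V x = pathComponentIn V y := by
      ext z
      exact ⟨fun hz => h.symm.trans hz, fun hz => h.trans hz⟩
    by_cases hj : JoinedIn V x0 x
    · have := hj.trans h
      simp [c, hj, this]
    · have : ¬ JoinedIn V x0 y := fun h' => hj (h'.trans h.symm)
      simp [c, hx, hy, hj, this, e]
  have hl : ∀ x, x ∈ W true → x ∈ W false → ∀ᶠ y in 𝓝 x, c y = c x := by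
    intro x hx hx'
    have hV : IsOpen V := (hW _).inter (hW _)
    have := (hV.pathComponentIn x).mem_nhds (mem_pathComponentIn_self ⟨hx, hx'⟩)
    filter_upwards [this] with y hy
    exact (hcj _ _ hy).symm
  have hpath : ∀ b x, ∃ α : Path x0 x, x ∈ W b → ∀ t, α t ∈ W b := by
    have hpc : PathConnectedSpace X := by
      rw [pathConnectedSpace_iff_eq]
      refine ⟨x0, ?_⟩
      ext x
      simp only [Set.mem_univ, iff_true]
      obtain ⟨b, hb⟩ := hc x
      exact ((hs b).isPathConnected.joinedIn x0 (h0 b) x hb).joined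
    intro b x
    by_cases hx : x ∈ W b
    · have := (hs b).isPathConnected.joinedIn x0 (h0 b) x hx
      exact ⟨this.somePath, fun _ => this.somePath_mem⟩
    · exact ⟨PathConnectedSpace.somePath x0 x, fun h => absurd h hx⟩
  choose α hα using hpath
  let ψ : FreeGroup J →* FundamentalGroup X x0 := FreeGroup.lift 
    (fun j => cls ((α true (rep j)).trans (α false (rep j)).symm))
  have hψ : ∀ j, ψ (.of j) = cls ((α true (rep j)).trans (α false (rep j)).symm) := by
    intro j; simp [ψ]
  have hjoin : ∀ x y, JoinedIn V x y → cls ((α true x).trans (α false x).symm) = 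
      cls ((α true y).trans (α false y).symm) := by
    intro x y h
    have k : ∀ b, x ∈ W b → y ∈ W b → (∀ t, h.somePath t ∈ W b) → 
      Path.Homotopic.Quotient.mk (α b y) = (Path.Homotopic.Quotient.mk (α b x)).trans (.mk h.somePath) := by
      intro b hx hy hb
      rw [← Path.Homotopic.Quotient.mk_trans]
      refine Path.Homotopic.Quotient.eq.2 (homotopic_of_mem (hs b) _ _ (hα b y hy) ?_)
      intro t
      rw [Path.trans_apply]
      split_ifs
      · exact hα b x hx _
      · exact hb _
    have k1 := k true h.source_mem.1 h.target_mem.1 (fun t => (h.somePath_mem t).1)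
    have k2 := k false h.source_mem.2 h.target_mem.2 (fun t => (h.somePath_mem t).2)
    unfold cls
    have k3 : Path.Homotopic.Quotient.mk (α true x) = 
        (Path.Homotopic.Quotient.mk (α true y)).trans (.symm (.mk h.somePath)) := by
      rw [k1, Path.Homotopic.Quotient.trans_assoc, Path.Homotopic.Quotient.trans_symm, 
        Path.Homotopic.Quotient.trans_refl]
    have k4 : Path.Homotopic.Quotient.mk (α false y).symm = 
        (Path.Homotopic.Quotient.symm (.mk h.somePath)).trans (.mk (α false x).symm) := by
      rw [Path.Homotopic.Quotient.mk_symm, k2, ← Path.Homotopic.Quotient.mk_trans,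
        ← Path.Homotopic.Quotient.mk_symm, Path.trans_symm]
      rfl
    rw [Path.Homotopic.Quotient.mk_trans, Path.Homotopic.Quotient.mk_trans, k3, k4,
      Path.Homotopic.Quotient.trans_assoc]
  have hsurj : ψ.range = ⊤ := by
    refine vk_gen W hW hc hs x0 α hα h0 _ ?_
    intro x hx hx'
    by_cases hj : JoinedIn V x0 x
    · rw [← hjoin _ _ hj]
      have : cls ((α true x0).trans (α false x0).symm) = 1 := by
        have t1 : cls (α true x0) = 1 := by
          rw [← cls_refl, cls_eq]
          exact homotopic_of_mem (hs true) _ _ (hα _ _ (h0 _)) (fun _ => h0 _)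
        have t2 : cls (α false x0).symm = 1 := by
          rw [← cls_refl, cls_eq]
          exact homotopic_of_mem (hs false) _ _ (fun t => hα _ _ (h0 _) _) (fun _ => h0 _)
        rw [← cls_mul, t1, t2, one_mul]
      rw [this]; exact one_mem _
    · let j : J := ⟨pathComponentIn V x, x, ⟨hx, hx'⟩, hj, rfl⟩
      have : JoinedIn V (rep j) x := by
        have : x ∈ pathComponentIn V (rep j) := by
          rw [hrA j]; exact mem_pathComponentIn_self ⟨hx, hx'⟩
        exact this
      rw [← hjoin _ _ this, ← hψ]
      exact ⟨_, rfl⟩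
  obtain ⟨F, m, ι, hι, hm⟩ := vk_mon W hW hc c hl x0 h0 hc0
  have hmψ : ∀ w g, m (ψ w) (ι g) = ι (w * g) := by
    intro w
    induction w using FreeGroup.induction_on with
    | C1 => intro g; rw [map_one, map_one, one_mul]; rfl
    | of j => 
      intro g
      rw [hψ, hm _ _ _ (hα true _ (hrV j).1) (hα false _ (hrV j).2), hcr]
    | inv_of j ih =>
      intro g
      rw [map_inv, map_inv, Equiv.Perm.inv_eq_iff_eq, ih, mul_inv_cancel_left]
    | mul x y hx hy =>
      intro g
      rw [map_mul, map_mul, Equiv.Perm.mul_apply, hy, hx, mul_assoc]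
  have hinj : Function.Injective ψ := by
    rw [injective_iff_map_eq_one]
    intro w hw
    have := hmψ w 1
    rw [hw, map_one, mul_one] at this
    exact (hι this).symm
  exact center_bot_congr (MulEquiv.ofBijective ψ ⟨hinj, MonoidHom.range_eq_top.1 hsurj⟩) 
    freeGroup_center_bot

end PBraid

open scoped unitInterval Topology
namespace PBraid

theorem punct_pathConn {n : ℕ} (q : Fin n → ℂ) : PathConnectedSpace {x : ℂ // ∀ i, x ≠ q i} := by
  have h := (Set.finite_range q).countable.isPathConnected_compl_of_one_lt_rank (E := ℂ) 
    (by rw [Complex.rank_real_complex]; norm_num)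
  have e : (Set.range q)ᶜ = {x : ℂ | ∀ i, x ≠ q i} := by
    ext x; simp [eq_comm]
  rw [e] at h
  exact isPathConnected_iff_pathConnectedSpace.1 h

/-- slit plane -/
def slit (n : ℕ) (ε : ℝ) : Set ℂ := {x | 0 < ε * x.im ∨ ∀ i : Fin n, x.re ≠ (i : ℕ)}

theorem slit_open (n : ℕ) (ε : ℝ) : IsOpen (slit n ε) := by
  have : slit n ε = {x | 0 < ε * x.im} ∪ ⋂ i : Fin n, {x : ℂ | x.re ≠ (i : ℕ)} := by
    ext x; simp [slit]
  rw [this]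
  refine (isOpen_lt (by fun_prop) (by fun_prop)).union (isOpen_iInter_of_finite fun i => ?_)
  exact isOpen_ne_fun (by fun_prop) (by fun_prop)

theorem slit_sc (n : ℕ) (ε : ℝ) (hε : ε * ε = 1) : IsSimplyConnected (slit n ε) := by
  have hmem : ∀ (t : I) (z : ℂ), z ∈ slit n ε → z + (t:ℝ) * ((ε * (|z.im| + 1) : ℝ) * Complex.I) ∈ slit n ε := by
    intro t z hz
    have ht := t.2.1
    rcases hz with hz | hz
    · left
      simp only [Complex.add_im, Complex.mul_im, Complex.ofReal_re, Complex.ofReal_im, Complex.I_re, Complex.I_im, Complex.mul_re]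
      have : ε * (z.im + (t:ℝ) * (ε * (|z.im| + 1))) = ε * z.im + (t:ℝ) * (ε * ε) * (|z.im| + 1) := by ring
      have h2 : 0 ≤ (t:ℝ) * (|z.im| + 1) := by positivity
      rw [hε, mul_one] at this
      ring_nf at this h2 ⊢
      nlinarith
    · right
      intro i
      have := hz i
      simpa using this
  have hup : ∀ (t : I) (z : ℂ), 0 < ε * ((1 - (t:ℝ)) * (z + ((ε * (|z.im| + 1) : ℝ) * Complex.I)) + (t:ℝ) * ((ε : ℂ) * Complex.I)).im := by
    intro t z
    have ht := t.2.1
    have ht' := t.2.2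
    simp
    have h1 : ε * ((1 - (t:ℝ)) * (z.im + ε * (|z.im| + 1)) + t * ε) = (1 - (t:ℝ)) * (ε * z.im + (ε*ε) * |z.im|) + (ε * ε) := by ring
    rw [h1, hε]
    have h3 : |ε| = 1 := by
      rcases mul_self_eq_one_iff.1 hε with h | h <;> simp [h]
    have h2 : 0 ≤ ε * z.im + |z.im| := by
      have : |ε * z.im| = |z.im| := by rw [abs_mul, h3, one_mul]
      have := neg_abs_le (ε * z.im)
      linarith
    have : 0 ≤ (1 - (t:ℝ)) * (ε * z.im + 1 * |z.im|) := mul_nonneg (by linarith) (by linarith)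
    linarith
  let f1 : C(slit n ε, slit n ε) := ⟨fun z => ⟨z.1 + (1:ℝ) * ((ε * (|z.1.im| + 1) : ℝ) * Complex.I), hmem 1 z.1 z.2⟩, by fun_prop⟩
  have hp : ((ε : ℂ) * Complex.I) ∈ slit n ε := by
    left; simp [hε]
  let H1 : (ContinuousMap.id (slit n ε)).Homotopy f1 := 
    { toFun := fun x => ⟨x.2.1 + (x.1:ℝ) * ((ε * (|x.2.1.im| + 1) : ℝ) * Complex.I), hmem x.1 x.2.1 x.2.2⟩
      continuous_toFun := by fun_prop
      map_zero_left := by intro z; apply Subtype.ext; simp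
      map_one_left := by intro z; rfl }
  let H2 : f1.Homotopy (ContinuousMap.const _ ⟨_, hp⟩) := 
    { toFun := fun x => ⟨(1 - (x.1:ℝ)) * (x.2.1 + ((ε * (|x.2.1.im| + 1) : ℝ) * Complex.I)) + (x.1:ℝ) * ((ε : ℂ) * Complex.I), Or.inl (hup x.1 x.2.1)⟩
      continuous_toFun := by fun_prop
      map_zero_left := by intro z; apply Subtype.ext; simp [f1]
      map_one_left := by intro z; apply Subtype.ext; simp }
  have : ContractibleSpace (slit n ε) := 
    contractible_iff_id_nullhomotopic _ |>.2 ⟨_, ⟨H1.trans H2⟩⟩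
  exact (inferInstance : SimplyConnectedSpace (slit n ε))

theorem punct_center (n : ℕ) (hn : 2 ≤ n) (x : {x : ℂ // ∀ i : Fin n, x ≠ ((i:ℕ):ℂ)}) :
    Subgroup.center (FundamentalGroup _ x) = ⊥ := by
  let Y : Type := {x : ℂ // ∀ i : Fin n, x ≠ ((i:ℕ):ℂ)}
  have hpc : PathConnectedSpace Y := punct_pathConn (fun i : Fin n => ((i:ℕ):ℂ))
  let s : Bool → ℝ := fun b => if b then 1 else -1
  have hs : ∀ b, s b * s b = 1 := by intro b; cases b <;> simp [s]
  let W : Bool → Set Y := fun b => Subtype.val ⁻¹' (slit n (s b))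
  have hslit : ∀ b, ∀ z ∈ slit n (s b), ∀ i : Fin n, z ≠ ((i:ℕ):ℂ) := by
    rintro b z hz i rfl
    rcases hz with h | h
    · simp at h
    · exact h i (by simp)
  have hYo : IsOpen {x : ℂ | ∀ i : Fin n, x ≠ ((i:ℕ):ℂ)} := by
    simp only [Set.ofPred_forall]
    exact isOpen_iInter_of_finite fun i => isOpen_ne
  have : LocallyPathConnectedSpace Y := hYo.locallyPathConnectedSpace
  have hgood : ∀ r : ℝ, (∀ i : ℕ, r ≠ i) → (∀ i : Fin n, (r:ℂ) ≠ ((i:ℕ):ℂ)) ∧ ∀ b, (r:ℂ) ∈ slit n (s b) := by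
    intro r hr
    refine ⟨fun i h => hr i (by exact_mod_cast h), fun b => Or.inr fun i => ?_⟩
    simpa using hr i
  have h0 := hgood (-1) (by intro i h; have : (0:ℝ) ≤ i := by positivity
                            linarith)
  have h1 := hgood (1/2) (by 
    intro i h
    have : (1:ℝ) = 2 * i := by linarith
    have : 1 = 2 * i := by exact_mod_cast this
    omega)
  have h2 := hgood (3/2) (by 
    intro i h
    have : (3:ℝ) = 2 * i := by linarith
    have : 3 = 2 * i := by exact_mod_cast this
    omega)
  have hsep : ∀ (y z : Y) (i : Fin n), y.1.re ≤ i → (i:ℕ) ≤ z.1.re → ¬ JoinedIn (W true ∩ W false) y z := by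
    intro y z i hy hz hj
    have hcont : Continuous (fun t => (Subtype.val (hj.somePath t)).re) :=
      Complex.continuous_re.comp (continuous_subtype_val.comp hj.somePath.continuous)
    obtain ⟨t, ht⟩ := mem_range_of_exists_le_of_exists_ge hcont (c := ((i:ℕ):ℝ)) ⟨0, by simpa using hy⟩ ⟨1, by simpa using hz⟩
    have hm := hj.somePath_mem t
    obtain ⟨ha, hb⟩ := hm
    rcases ha with ha | ha
    · rcases hb with hb | hb
      · simp only [s] at ha hb
        simp at ha hb
        linarith
      · exact hb i ht
    · exact ha i ht
  have main := vk_center W (fun b => (slit_open n _).preimage continuous_subtype_val) ?_ ?_ 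
    ⟨_, h0.1⟩ ⟨_, h1.1⟩ ⟨_, h2.1⟩ h0.2 h1.2 h2.2 
    (hsep _ _ ⟨0, by omega⟩ (by simp) (by simp)) 
    (hsep _ _ ⟨0, by omega⟩ (by simp) (by simp; norm_num)) 
    (hsep _ _ ⟨1, by omega⟩ (by simp; norm_num) (by simp; norm_num)) 
  · exact center_bot_congr (FundamentalGroup.fundamentalGroupMulEquivOfPathConnected _ _) main
  · intro y
    rcases lt_trichotomy y.1.im 0 with h | h | h
    · exact ⟨false, Or.inl (by simp [s, h])⟩
    · refine ⟨true, Or.inr fun i hi => y.2 i ?_⟩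
      apply Complex.ext <;> simp [h, hi]
    · exact ⟨true, Or.inl (by simp [s, h])⟩
  · intro b
    rw [← (Topology.IsEmbedding.subtypeVal (p := fun x : ℂ => ∀ i : Fin n, x ≠ ((i:ℕ):ℂ))).isSimplyConnected_image]
    have : Subtype.val '' W b = slit n (s b) := by
      change Subtype.val '' (Subtype.val ⁻¹' slit n (s b) : Set {x : ℂ | ∀ i : Fin n, x ≠ ((i:ℕ):ℂ)}) = _
      rw [Subtype.image_preimage_coe]
      exact Set.inter_eq_right.2 (hslit b)
    rw [this]
    exact slit_sc n _ (hs b)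

end PBraid

open scoped unitInterval Topology
namespace PBraid

/-- Normalized configurations. -/
abbrev XX (m : ℕ) : Type := {z : Fin (m+2) → ℂ // Function.Injective z ∧ z 0 = 0 ∧ z 1 = 1}

/-- minimal distance -/
noncomputable def sep {m : ℕ} (q : Fin (m+2) → ℂ) : ℝ :=
  (Finset.univ.offDiag).inf' ⟨((0 : Fin (m+2)), (1 : Fin (m+2))), by simp⟩
    (fun ij : Fin (m+2) × Fin (m+2) => dist (q ij.1) (q ij.2))

theorem sep_cont {m : ℕ} : Continuous (sep (m := m)) := by
  unfold sep
  refine Continuous.finset_inf'_apply _ ?_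
  intro i _
  fun_prop

theorem sep_pos {m : ℕ} {q : Fin (m+2) → ℂ} (hq : Function.Injective q) : 0 < sep q := by
  unfold sep
  refine (Finset.lt_inf'_iff _).2 ?_
  rintro ⟨i, j⟩ h
  simp at h
  exact dist_pos.2 (hq.ne h)

theorem sep_le {m : ℕ} (q : Fin (m+2) → ℂ) {i j : Fin (m+2)} (h : i ≠ j) :
    sep q ≤ dist (q i) (q j) := by
  unfold sep
  exact Finset.inf'_le (f := fun ij : Fin (m+2) × Fin (m+2) => dist (q ij.1) (q ij.2)) (b := (i, j)) (by simpa using h)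

/-- the slide of the last point -/
noncomputable def slideFn {m : ℕ} (q q' : Fin (m+2) → ℂ) (x : ℂ) : ℂ :=
  x + ∑ i, ((max 0 (1 - dist x (q i) / (sep q / 4)) : ℝ) : ℂ) * (q' i - q i)

theorem slideFn_ne {m : ℕ} (q q' : Fin (m+2) → ℂ) (x : ℂ) (hq : Function.Injective q)
    (hd : dist q q' < sep q / 4) (hx : ∀ i, x ≠ q i) (j : Fin (m+2)) : slideFn q q' x ≠ q' j := by
  have hs := sep_pos hq
  set r := sep q / 4 with hr
  have hr0 : 0 < r := by positivity
  have hdi : ∀ i, ‖q' i - q i‖ < r := by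
    intro i
    have := dist_le_pi_dist q q' i
    rw [dist_comm, dist_eq_norm] at this
    linarith
  have hsep : ∀ {i k}, i ≠ k → 4 * r ≤ ‖q i - q k‖ := by
    intro i k h
    have := sep_le q h
    rw [dist_eq_norm] at this
    linarith
  by_cases hb : ∃ i, dist x (q i) < r
  · obtain ⟨i, hi⟩ := hb
    have hsum : slideFn q q' x = x + ((1 - dist x (q i) / r : ℝ) : ℂ) * (q' i - q i) := by
      unfold slideFn
      rw [Finset.sum_eq_single i]
      · have : 0 ≤ 1 - dist x (q i) / r := by
          rw [sub_nonneg, div_le_one hr0]; exact hi.le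
        rw [← hr, max_eq_right this]
      · intro k _ hk
        have h1 := hsep hk
        have h2 : r ≤ dist x (q k) := by
          have := dist_triangle (q k) x (q i)
          rw [dist_eq_norm (q k) (q i), dist_comm (q k) x] at this
          linarith
        have : 1 - dist x (q k) / r ≤ 0 := by
          rw [sub_nonpos, one_le_div hr0]; exact h2
        rw [← hr, max_eq_left this]; simp
      · simp
    rw [hsum]
    have hpos : 0 < dist x (q i) := dist_pos.2 (hx i)
    set d := dist x (q i) with hdd
    have hdn : d = ‖x - q i‖ := dist_eq_norm _ _
    intro heq
    by_cases hij : j = i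
    · subst hij
      have e : x - q j = ((d / r : ℝ) : ℂ) * (q' j - q j) := by
        push_cast at heq ⊢
        linear_combination heq
      have := congrArg norm e
      rw [norm_mul, Complex.norm_real, Real.norm_of_nonneg (by positivity), ← hdn] at this
      have h3 : d / r * ‖q' j - q j‖ < d / r * r := mul_lt_mul_of_pos_left (hdi j) (by positivity)
      rw [div_mul_cancel₀ _ hr0.ne'] at h3
      linarith
    · have e : q i - q j = (q' j - q j) - (x - q i) - ((1 - d / r : ℝ) : ℂ) * (q' i - q i) := by
        linear_combination heq
      have h1 := hsep (Ne.symm hij)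
      rw [e] at h1
      have h2 := norm_sub_le ((q' j - q j) - (x - q i)) (((1 - d / r : ℝ) : ℂ) * (q' i - q i))
      have h3 := norm_sub_le (q' j - q j) (x - q i)
      have h4 : ‖((1 - d / r : ℝ) : ℂ) * (q' i - q i)‖ ≤ r := by
        rw [norm_mul, Complex.norm_real]
        have h5 : ‖1 - d / r‖ ≤ 1 := by
          have : d / r < 1 := by rw [div_lt_one hr0]; exact hi
          have : 0 < d / r := by positivity
          rw [Real.norm_eq_abs, abs_le]; constructor <;> linarith
        have := hdi i
        have := norm_nonneg (q' i - q i)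
        nlinarith [norm_nonneg (1 - d / r)]
      have := hdi j
      linarith
  · push Not at hb
    have hsum : slideFn q q' x = x := by
      unfold slideFn
      rw [Finset.sum_eq_zero, add_zero]
      intro k _
      have : 1 - dist x (q k) / r ≤ 0 := by
        rw [sub_nonpos, one_le_div hr0]; exact hb k
      rw [← hr, max_eq_left this]; simp
    rw [hsum]
    rintro rfl
    have h1 := hb j
    have h2 := hdi j
    rw [dist_eq_norm] at h1
    linarith

theorem slideFn_self {m : ℕ} (q : Fin (m+2) → ℂ) (x : ℂ) : slideFn q q x = x := by
  simp [slideFn]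

theorem snoc_inj {m : ℕ} {q : Fin (m+2) → ℂ} (hq : Function.Injective q) {x : ℂ} (hx : ∀ i, x ≠ q i) :
    Function.Injective (Fin.snoc (α := fun _ => ℂ) q x : Fin (m+3) → ℂ) := by
  intro i j h
  induction i using Fin.lastCases with
  | last =>
    induction j using Fin.lastCases with
    | last => rfl
    | cast j => simp at h; exact absurd h (hx j)
  | cast i =>
    induction j using Fin.lastCases with
    | last => simp at h; exact absurd h.symm (hx i)
    | cast j => simp at h; rw [hq h]

/-- adding a last point -/
noncomputable def snocX {m : ℕ} (q : XX m) (x : ℂ) (hx : ∀ i, x ≠ q.1 i) : XX (m+1) :=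
  ⟨Fin.snoc (α := fun _ => ℂ) q.1 x, snoc_inj q.2.1 hx, by
    have : (0 : Fin (m+1+2)) = Fin.castSucc (0 : Fin (m+2)) := rfl
    rw [this, Fin.snoc_castSucc]; exact q.2.2.1, by
    have : (1 : Fin (m+1+2)) = Fin.castSucc (1 : Fin (m+2)) := rfl
    rw [this, Fin.snoc_castSucc]; exact q.2.2.2⟩

theorem XX_coord {m : ℕ} (i) : Continuous fun z : XX m => z.1 i :=
  (continuous_apply i).comp continuous_subtype_val

theorem slideFn_cont {m : ℕ} {T : Type*} [TopologicalSpace T] {q q' : T → Fin (m+2) → ℂ} {x : T → ℂ}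
    (hq : Continuous q) (hq' : Continuous q') (hx : Continuous x) (h : ∀ t, sep (q t) ≠ 0) :
    Continuous fun t => slideFn (q t) (q' t) (x t) := by
  unfold slideFn
  have hs : Continuous fun t => sep (q t) := sep_cont.comp hq
  have h3 : ∀ t, sep (q t) / 4 ≠ 0 := fun t => div_ne_zero (h t) (by norm_num)
  refine hx.add (continuous_finsetSum _ fun i _ => ?_)
  have hqi := (continuous_apply i).comp hq
  have hqi' := (continuous_apply i).comp hq'
  refine Continuous.mul ?_ (hqi'.sub hqi)
  refine Complex.continuous_ofReal.comp (continuous_const.max (continuous_const.sub ?_))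
  exact (hx.dist hqi).div (hs.div_const _) h3

/-- forgetting the last point -/
noncomputable def initX (m : ℕ) : C(XX (m+1), XX m) where
  toFun z := ⟨fun i => z.1 i.castSucc, 
    fun i j h => Fin.castSucc_injective _ (z.2.1 h), z.2.2.1, z.2.2.2⟩
  continuous_toFun := Continuous.subtype_mk (continuous_pi fun i => XX_coord _) _

theorem last_ne {m : ℕ} (z : XX (m+1)) (i) : z.1 (Fin.last _) ≠ (initX m z).1 i := by
  intro h
  exact (Fin.castSucc_lt_last i).ne' (z.2.1 h)

theorem initX_snocX {m : ℕ} (q : XX m) (x : ℂ) (hx) : initX m (snocX q x hx) = q := by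
  apply Subtype.ext; funext i
  simp [initX, snocX]

theorem snocX_initX {m : ℕ} (z : XX (m+1)) (hx) : snocX (initX m z) (z.1 (Fin.last _)) hx = z := by
  apply Subtype.ext
  exact Fin.snoc_init_self z.1

theorem snocX_congr {m : ℕ} (q : XX m) {x y : ℂ} (h : x = y) (hx) (hy) :
    snocX q x hx = snocX q y hy := by
  subst h; rfl

theorem initX_transport (m : ℕ) : HasTransport (initX m) := by
  let S : C({x : XX (m+1) × XX m // dist (initX m x.1) x.2 < sep (initX m x.1).1 / 4}, XX (m+1)) :=
    { toFun := fun x => snocX x.1.2 (slideFn (initX m x.1.1).1 x.1.2.1 (x.1.1.1 (Fin.last _)))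
        (slideFn_ne _ _ _ (initX m x.1.1).2.1 x.2 (last_ne _))
      continuous_toFun := by
        refine Continuous.subtype_mk ?_ _
        refine Continuous.finSnoc (continuous_subtype_val.comp (continuous_snd.comp continuous_subtype_val)) ?_
        refine slideFn_cont ?_ ?_ ?_ (fun x => (sep_pos (initX m x.1.1).2.1).ne')
        · exact continuous_subtype_val.comp ((initX m).continuous.comp (continuous_fst.comp continuous_subtype_val))
        · exact continuous_subtype_val.comp (continuous_snd.comp continuous_subtype_val)
        · exact (XX_coord _).comp (continuous_fst.comp continuous_subtype_val) }
  refine hasTransport_of_slide (initX m) ⟨fun q => sep q.1 / 4, (sep_cont.comp continuous_subtype_val).div_const _⟩ 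
    (fun q => div_pos (sep_pos q.2.1) (by norm_num)) S ?_ ?_
  · intro x
    exact initX_snocX x.1.2 _ (slideFn_ne _ _ _ (initX m x.1.1).2.1 x.2 (last_ne _))
  · rintro ⟨⟨z, q⟩, hd⟩ h
    dsimp only at h
    subst h
    exact (snocX_congr _ (slideFn_self _ _)
      (slideFn_ne _ _ _ (initX m z).2.1 hd (last_ne _)) (last_ne z)).trans (snocX_initX z (last_ne z))

/-- the fibre -/
noncomputable def fibX {m : ℕ} (e : XX (m+1)) : {z : XX (m+1) // initX m z = initX m e} ≃ₜ
    {w : ℂ // ∀ i : Fin (m+2), w ≠ (initX m e).1 i} where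
  toFun z := ⟨z.1.1 (Fin.last _), fun i => by have := last_ne z.1 i; rwa [z.2] at this⟩
  invFun w := ⟨snocX (initX m e) w.1 w.2, initX_snocX _ _ _⟩
  left_inv z := by
    obtain ⟨z, hz⟩ := z
    apply Subtype.ext
    simp only [← hz]
    exact snocX_initX _ _
  right_inv w := by
    apply Subtype.ext
    simp [snocX]
  continuous_toFun := Continuous.subtype_mk ((XX_coord _).comp continuous_subtype_val) _
  continuous_invFun := by
    refine Continuous.subtype_mk (Continuous.subtype_mk ?_ _) _
    exact Continuous.finSnoc continuous_const continuous_subtype_val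

theorem fib_pc {m : ℕ} (e : XX (m+1)) : PathConnectedSpace {z : XX (m+1) // initX m z = initX m e} := by
  have := punct_pathConn (initX m e).1
  exact (fibX e).symm.surjective.pathConnectedSpace (fibX e).symm.continuous

/-- standard configuration -/
noncomputable def stdX (m : ℕ) : XX m := ⟨fun i => ((i : ℕ) : ℂ), by
  intro i j h
  have : (i : ℕ) = j := Nat.cast_injective h
  exact Fin.ext this, by simp, by simp⟩

theorem XX_pc (m : ℕ) : PathConnectedSpace (XX m) := by
  induction m with
  | zero =>
    have : Subsingleton (XX 0) := by
      refine ⟨fun a b => Subtype.ext (funext fun i => ?_)⟩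
      fin_cases i
      · exact a.2.2.1.trans b.2.2.1.symm
      · exact a.2.2.2.trans b.2.2.2.symm
    exact { nonempty := ⟨stdX 0⟩, joined := fun x y => by rw [Subsingleton.elim x y] }
  | succ m ih => 
    exact pathConnected_of_transport (initX m) (initX_transport m) ⟨stdX _⟩ fib_pc

theorem XX_center (m : ℕ) (x : XX m) : Subgroup.center (FundamentalGroup (XX m) x) = ⊥ := by
  induction m with
  | zero =>
    have : Subsingleton (XX 0) := by
      refine ⟨fun a b => Subtype.ext (funext fun i => ?_)⟩
      fin_cases i
      · exact a.2.2.1.trans b.2.2.1.symm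
      · exact a.2.2.2.trans b.2.2.2.symm
    rw [Subgroup.eq_bot_iff_forall]
    intro z _
    obtain ⟨u, rfl⟩ := cls_surj z
    have : u = Path.refl x := by ext t; simp [Subsingleton.elim (u t) x]
    rw [this, cls_refl]
  | succ m ih => 
    have := XX_pc (m+1)
    let e : XX (m+1) := stdX (m+1)
    have := fib_pc e
    have key : Subgroup.center (FundamentalGroup (XX (m+1)) e) = ⊥ := by
      refine center_of_transport (initX m) (initX_transport m) e (ih _) ?_
      obtain ⟨E⟩ := pi1_homeo (fibX e) (fibX e ⟨e, rfl⟩)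
      rw [Homeomorph.symm_apply_apply] at E
      exact center_bot_congr E (punct_center (m+2) (by omega) _)
    exact center_bot_congr (FundamentalGroup.fundamentalGroupMulEquivOfPathConnected _ _) key

end PBraid

open scoped unitInterval Topology
namespace PBraid

/-- general position in codimension at least three -/
theorem vec_perturb {m : ℕ} (hm : 3 ≤ m) (g : C(I × I, Fin m → ℝ)) (S : Set (I × I))
    (hS : IsClosed S) (hg : ∀ x ∈ S, g x ≠ 0) (ε : ℝ) (hε : 0 < ε) :
    ∃ d : C(I × I, Fin m → ℝ), (∀ x, ‖d x‖ < ε) ∧ (∀ x ∈ S, d x = 0) ∧ ∀ x, g x + d x ≠ 0 := by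
  obtain ⟨δ, hδ, hδS⟩ : ∃ δ : ℝ, 0 < δ ∧ ∀ x ∈ S, δ ≤ ‖g x‖ := by
    rcases S.eq_empty_or_nonempty with rfl | hne
    · exact ⟨1, one_pos, by simp⟩
    · obtain ⟨x, hx, hmin⟩ := hS.isCompact.exists_isMinOn hne (f := fun x => ‖g x‖)
        (by fun_prop)
      exact ⟨‖g x‖, norm_pos_iff.2 (hg x hx), fun y hy => hmin hy⟩
  obtain ⟨r, hr, hrε, hrδ⟩ : ∃ r : ℝ, 0 < r ∧ 2 * r < ε ∧ 8 * r ≤ δ := by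
    refine ⟨min (ε / 4) (δ / 8), by positivity, ?_, ?_⟩
    · have := min_le_left (ε / 4) (δ / 8); linarith
    · have := min_le_right (ε / 4) (δ / 8); linarith
  let pr : ℝ × ℝ → I × I := fun x => (Set.projIcc 0 1 zero_le_one x.1, Set.projIcc 0 1 zero_le_one x.2)
  have hpr : Continuous pr := by
    exact (continuous_projIcc.comp continuous_fst).prodMk (continuous_projIcc.comp continuous_snd)
  obtain ⟨P, hP, hPd, -⟩ := Continuous.exists_contDiff_approx (f := fun x => g (pr x))
    (ε := fun _ => r) 1 (g.continuous.comp hpr) continuous_const (fun _ => hr)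
  have hdense := ContDiff.dense_compl_range_of_finrank_lt_finrank (f := P) hP (by simp; omega)
  obtain ⟨c, hc, hcr⟩ := hdense.exists_dist_lt (0 : Fin m → ℝ) hr
  rw [dist_comm, dist_zero_right] at hcr
  let inc : I × I → ℝ × ℝ := fun x => (x.1, x.2)
  have hinc : Continuous inc := by fun_prop
  have hpi : ∀ x, pr (inc x) = x := fun x => by
    simp [pr, inc]
  have hPx : ∀ x, ‖P (inc x) - c - g x‖ ≤ 2 * r := fun x => by
    have h1 := hPd (inc x)
    rw [hpi, dist_eq_norm] at h1
    have h2 := norm_sub_le (P (inc x) - g x) c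
    have : P (inc x) - c - g x = P (inc x) - g x - c := by abel
    rw [this]; linarith
  let χ : ℝ → ℝ := fun ρ => max 0 (min 1 (2 - ρ / (4 * r)))
  have hχ : Continuous χ := by fun_prop
  have hχ0 : ∀ ρ, 0 ≤ χ ρ := fun ρ => le_max_left _ _
  have hχ1 : ∀ ρ, χ ρ ≤ 1 := fun ρ => max_le zero_le_one (min_le_left _ _)
  let d : C(I × I, Fin m → ℝ) := ⟨fun x => χ ‖g x‖ • (P (inc x) - c - g x), by
    have := hP.continuous
    fun_prop⟩
  have hd : ∀ x, ‖d x‖ ≤ 2 * r := fun x => by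
    change ‖χ ‖g x‖ • (P (inc x) - c - g x)‖ ≤ _
    rw [norm_smul, Real.norm_eq_abs, abs_of_nonneg (hχ0 _)]
    calc _ ≤ 1 * (2 * r) := mul_le_mul (hχ1 _) (hPx x) (norm_nonneg _) zero_le_one
      _ = _ := one_mul _
  refine ⟨d, fun x => (hd x).trans_lt hrε, fun x hx => ?_, fun x h => ?_⟩
  · change χ ‖g x‖ • (P (inc x) - c - g x) = 0
    have : χ ‖g x‖ = 0 := by
      refine max_eq_left ((min_le_right _ _).trans ?_)
      have : 2 ≤ ‖g x‖ / (4 * r) := by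
        rw [le_div_iff₀ (by positivity)]
        linarith [hδS x hx]
      linarith
    rw [this, zero_smul]
  · rcases le_or_gt ‖g x‖ (4 * r) with h4 | h4
    · have : χ ‖g x‖ = 1 := by
        have : ‖g x‖ / (4 * r) ≤ 1 := by
          rw [div_le_one (by positivity)]; exact h4
        change max 0 (min 1 (2 - ‖g x‖ / (4 * r))) = 1
        rw [min_eq_left (by linarith), max_eq_right zero_le_one]
      change g x + χ ‖g x‖ • (P (inc x) - c - g x) = 0 at h
      rw [this, one_smul] at h
      apply hc
      refine ⟨inc x, ?_⟩
      have h' : P (inc x) - c = 0 := by rw [← h]; abel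
      exact sub_eq_zero.1 h'
    · have h5 : g x = - d x := eq_neg_of_add_eq_zero_left h
      have := hd x
      rw [h5, norm_neg] at h4
      linarith

/-- imaginary parts -/
def imX {m : ℕ} (z : XX m) : Fin m → ℝ := fun j => (z.1 j.succ.succ).im

theorem imX_cont {m : ℕ} : Continuous (imX (m := m)) :=
  continuous_pi fun _ => Complex.continuous_im.comp (XX_coord _)

/-- noncollinear normalized configurations -/
abbrev EE (m : ℕ) : Type := {z : XX m // imX z ≠ 0}

/-- the vector of displacements -/
def disp {m : ℕ} (d : Fin m → ℝ) : Fin (m+2) → ℝ := Fin.cons 0 (Fin.cons 0 d)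

theorem disp_cont {m : ℕ} : Continuous (disp (m := m)) := by
  unfold disp
  refine continuous_pi fun i => ?_
  refine Fin.cases ?_ (fun i => Fin.cases ?_ (fun i => ?_) i) i
  · simp; exact continuous_const
  · simp; exact continuous_const
  · simp; exact continuous_apply i

theorem disp_le {m : ℕ} (d : Fin m → ℝ) (i) : |disp d i| ≤ ‖d‖ := by
  unfold disp
  refine Fin.cases ?_ (fun i => Fin.cases ?_ (fun i => ?_) i) i
  · simp
  · simp
  · simp; exact norm_le_pi_norm d i

theorem shift_inj {m : ℕ} (z : XX m) (d : Fin m → ℝ) (h : ‖d‖ < sep z.1 / 2) :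
    Function.Injective (fun i => z.1 i + disp d i * Complex.I) := by
  intro i j hij
  by_contra hne
  have h1 := sep_le z.1 hne
  have hk : ∀ k, ‖(disp d k : ℂ) * Complex.I‖ ≤ ‖d‖ := fun k => by simpa using disp_le d k
  rw [dist_eq_norm] at h1
  have : z.1 i - z.1 j = disp d j * Complex.I - disp d i * Complex.I := by
    linear_combination hij
  rw [this] at h1
  have := norm_sub_le (disp d j * Complex.I : ℂ) (disp d i * Complex.I)
  linarith [hk i, hk j]

theorem XX_perturb {m : ℕ} (hm : 3 ≤ m) (f : C(I × I, XX m)) (S : Set (I × I))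
    (hS : IsClosed S) (hf : ∀ x ∈ S, imX (f x) ≠ 0) :
    ∃ F : C(I × (I × I), XX m), (∀ x, F (0, x) = f x) ∧ (∀ x, imX (F (1, x)) ≠ 0) ∧
      ∀ s, ∀ x ∈ S, F (s, x) = f x := by
  obtain ⟨x0, -, hx0⟩ := isCompact_univ.exists_isMinOn (s := (Set.univ : Set (I × I)))
    Set.univ_nonempty (f := fun x => sep (f x).1)
    (sep_cont.comp (continuous_subtype_val.comp f.continuous)).continuousOn
  obtain ⟨d, hd, hdS, hdn⟩ := vec_perturb hm ⟨fun x => imX (f x), imX_cont.comp f.continuous⟩ S hS hf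
    (sep (f x0).1 / 2) (half_pos (sep_pos (f x0).2.1))
  have hlt : ∀ (s : I) x, ‖(s : ℝ) • d x‖ < sep (f x).1 / 2 := fun s x => by
    have h1 : sep (f x0).1 ≤ sep (f x).1 := hx0 (Set.mem_univ x)
    rw [norm_smul, Real.norm_eq_abs, abs_of_nonneg s.2.1]
    have := mul_le_of_le_one_left (norm_nonneg (d x)) s.2.2
    linarith [hd x]
  refine ⟨⟨fun p => ⟨fun i => (f p.2).1 i + disp ((p.1 : ℝ) • d p.2) i * Complex.I,
    shift_inj _ _ (hlt p.1 p.2), ?_, ?_⟩, ?_⟩, ?_, ?_, ?_⟩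
  · simp [disp, (f p.2).2.2.1]
  · have : disp ((p.1 : ℝ) • d p.2) 1 = 0 := rfl
    simp [this, (f p.2).2.2.2]
  · refine Continuous.subtype_mk (continuous_pi fun i => ?_) _
    refine ((XX_coord i).comp (f.continuous.comp continuous_snd)).add (Continuous.mul ?_ continuous_const)
    refine Complex.continuous_ofReal.comp ((continuous_apply i).comp (disp_cont.comp ?_))
    exact (continuous_subtype_val.comp continuous_fst).smul (d.continuous.comp continuous_snd)
  · intro x
    apply Subtype.ext; funext i
    have h0 := disp_le (0 : Fin m → ℝ) i
    have : disp (0 : Fin m → ℝ) i = 0 := by simpa using h0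
    simp [this]
  · intro x h
    apply hdn x
    rw [← h]
    funext j
    have : disp (((1 : I) : ℝ) • d x) j.succ.succ = d x j := by simp [disp]
    simp only [imX, ContinuousMap.coe_mk, this]
    simp [imX]
  · intro s x hx
    apply Subtype.ext; funext i
    have h0 := disp_le (0 : Fin m → ℝ) i
    have : disp (0 : Fin m → ℝ) i = 0 := by simpa using h0
    simp [hdS x hx, this]

/-- inclusion -/
def incE (m : ℕ) : C(EE m, XX m) := ⟨Subtype.val, continuous_subtype_val⟩

theorem EE_pi1 {m : ℕ} (hm : 3 ≤ m) (e : EE m) :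
    Nonempty (FundamentalGroup (EE m) e ≃* FundamentalGroup (XX m) (incE m e)) := by
  refine ⟨MulEquiv.ofBijective (FundamentalGroup.map (incE m) e) ⟨?_, ?_⟩⟩
  · intro a b hab
    obtain ⟨u, rfl⟩ := cls_surj a
    obtain ⟨v, rfl⟩ := cls_surj b
    rw [map_cls, map_cls] at hab
    obtain ⟨H⟩ := cls_eq.1 hab
    rw [cls_eq]
    let S : Set (I × I) := {x | x.1 = 0 ∨ x.1 = 1 ∨ x.2 = 0 ∨ x.2 = 1}
    have hS : IsClosed S := by
      refine (isClosed_eq continuous_fst continuous_const).union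
        ((isClosed_eq continuous_fst continuous_const).union
        ((isClosed_eq continuous_snd continuous_const).union
        (isClosed_eq continuous_snd continuous_const)))
    have e0 : ∀ t, H (0, t) = (u t).1 := fun t => H.apply_zero t
    have e1 : ∀ t, H (1, t) = (v t).1 := fun t => H.apply_one t
    have e2 : ∀ t, H (t, 0) = e.1 := fun t => H.source t
    have e3 : ∀ t, H (t, 1) = e.1 := fun t => H.target t
    obtain ⟨F, -, hF1, hFS⟩ := XX_perturb hm H.toContinuousMap S hS (by
      rintro ⟨s, t⟩ h
      rcases h with h | h | h | h <;> dsimp only at h <;> subst h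
      · exact (e0 t).symm ▸ (u t).2
      · exact (e1 t).symm ▸ (v t).2
      · exact (e2 s).symm ▸ e.2
      · exact (e3 s).symm ▸ e.2)
    have hFS' : ∀ s x, x ∈ S → F (s, x) = H x := hFS
    exact ⟨{ toFun := fun x => ⟨F (1, x), hF1 x⟩
             continuous_toFun := Continuous.subtype_mk
              (F.continuous.comp (continuous_const.prodMk continuous_id)) _
             map_zero_left := fun t => Subtype.ext ((hFS' 1 (0, t) (Or.inl rfl)).trans (e0 t))
             map_one_left := fun t => Subtype.ext ((hFS' 1 (1, t) (Or.inr (Or.inl rfl))).trans (e1 t))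
             prop' := by
              intro s t ht
              rcases ht with rfl | ht
              · refine Subtype.ext ((hFS' 1 (s, 0) (Or.inr (Or.inr (Or.inl rfl)))).trans ((e2 s).trans ?_))
                exact congrArg Subtype.val u.source.symm
              · obtain rfl : t = 1 := ht
                refine Subtype.ext ((hFS' 1 (s, 1) (Or.inr (Or.inr (Or.inr rfl)))).trans ((e3 s).trans ?_))
                exact congrArg Subtype.val u.target.symm }⟩
  · intro b
    obtain ⟨u, rfl⟩ := cls_surj b
    let S : Set (I × I) := {x | x.1 = 0 ∨ x.1 = 1}
    have hS : IsClosed S := 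
      (isClosed_eq continuous_fst continuous_const).union (isClosed_eq continuous_fst continuous_const)
    obtain ⟨F, hF0, hF1, hFS⟩ := XX_perturb hm ⟨fun x => u x.1, u.continuous.comp continuous_fst⟩ S hS (by
      rintro ⟨s, t⟩ h
      rcases h with h | h <;> dsimp only at h <;> subst h
      · change imX (u 0) ≠ 0
        rw [u.source]; exact e.2
      · change imX (u 1) ≠ 0
        rw [u.target]; exact e.2)
    have h0 : ∀ s, F (s, (0, 0)) = e.1 := fun s => (hFS s (0, 0) (Or.inl rfl)).trans u.source
    have h1 : ∀ s, F (s, (1, 0)) = e.1 := fun s => (hFS s (1, 0) (Or.inr rfl)).trans u.target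
    let w : Path e e :=
      { toFun := fun s => ⟨F (1, (s, 0)), hF1 _⟩
        continuous_toFun := Continuous.subtype_mk (F.continuous.comp (by fun_prop)) _
        source' := Subtype.ext (h0 1)
        target' := Subtype.ext (h1 1) }
    refine ⟨cls w, ?_⟩
    rw [map_cls, cls_eq]
    symm
    exact ⟨{ toFun := fun x => F (x.1, (x.2, 0))
             continuous_toFun := F.continuous.comp (by fun_prop)
             map_zero_left := fun t => hF0 (t, 0)
             map_one_left := fun t => rfl
             prop' := by
              intro s t ht
              rcases ht with rfl | ht
              · exact (h0 s).trans u.source.symm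
              · obtain rfl : t = 1 := ht
                exact (h1 s).trans u.target.symm }⟩

end PBraid

open scoped unitInterval Topology
namespace PBraid

/-- plane to complex -/
noncomputable def toC (v : Plane) : ℂ := ⟨v 0, v 1⟩
/-- complex to plane -/
noncomputable def ofC (z : ℂ) : Plane := ![z.re, z.im]

@[simp] theorem toC_ofC (z : ℂ) : toC (ofC z) = z := by
  apply Complex.ext <;> simp [toC, ofC]
@[simp] theorem ofC_toC (v : Plane) : ofC (toC v) = v := by
  funext i; fin_cases i <;> simp [toC, ofC]
theorem toC_inj {v w : Plane} (h : toC v = toC w) : v = w := by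
  rw [← ofC_toC v, h, ofC_toC]
theorem ofC_inj {v w : ℂ} (h : ofC v = ofC w) : v = w := by
  rw [← toC_ofC v, h, toC_ofC]
theorem toC_cont : Continuous toC := by
  have : toC = fun v : Plane => (v 0 : ℂ) + (v 1 : ℂ) * Complex.I := by
    funext v; apply Complex.ext <;> simp [toC]
  rw [this]; fun_prop
theorem ofC_cont : Continuous ofC := by
  refine continuous_pi fun i => ?_
  fin_cases i
  · exact Complex.continuous_re
  · exact Complex.continuous_im

theorem toC_sub_ne {m : ℕ} {p : Fin (m+2) → Plane} (hp : Function.Injective p) :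
    toC (p 1) - toC (p 0) ≠ 0 := by
  intro h
  have := hp (toC_inj (sub_eq_zero.1 h))
  simp at this

/-- normalization -/
noncomputable def nrm {m : ℕ} (p : Fin (m+2) → Plane) (hp : Function.Injective p) : XX m :=
  ⟨fun i => (toC (p i) - toC (p 0)) / (toC (p 1) - toC (p 0)), by
    intro i j h
    have h1 := toC_sub_ne hp
    have h2 := (div_left_inj' h1).1 h
    exact hp (toC_inj (sub_left_injective h2)), by simp, div_self (toC_sub_ne hp)⟩

/-- translation and scaling -/
abbrev TS : Type := ℂ × {x : ℂ // x ≠ 0}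

/-- the product decomposition -/
noncomputable def confHomeo (m : ℕ) : Conf (m+2) ≃ₜ TS × XX m where
  toFun p := ((toC (p.1 0), ⟨toC (p.1 1) - toC (p.1 0), toC_sub_ne p.2⟩), nrm p.1 p.2)
  invFun y := ⟨fun i => ofC (y.1.1 + y.1.2.1 * y.2.1 i), fun i j h => by
    have h1 := add_left_cancel (ofC_inj h)
    exact y.2.2.1 (mul_left_cancel₀ y.1.2.2 h1)⟩
  left_inv p := by
    apply Subtype.ext; funext i
    have h1 := toC_sub_ne p.2
    simp only [nrm]
    rw [mul_div_cancel₀ _ h1, add_sub_cancel, ofC_toC]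
  right_inv y := by
    obtain ⟨⟨c, l, hl⟩, z, hz, h0, h1⟩ := y
    refine Prod.ext (Prod.ext ?_ (Subtype.ext ?_)) (Subtype.ext (funext fun i => ?_))
    · simp [h0]
    · simp [h0, h1]
    · simp [nrm, h0, h1]; field_simp
  continuous_toFun := by
    have hc : ∀ i, Continuous fun p : Conf (m+2) => toC (p.1 i) := fun i =>
      toC_cont.comp ((continuous_apply i).comp continuous_subtype_val)
    refine ((hc 0).prodMk (((hc 1).sub (hc 0)).subtype_mk _)).prodMk (Continuous.subtype_mk ?_ _)
    exact continuous_pi fun i => ((hc i).sub (hc 0)).div ((hc 1).sub (hc 0)) fun p => toC_sub_ne p.2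
  continuous_invFun := by
    refine Continuous.subtype_mk (continuous_pi fun i => ofC_cont.comp ?_) _
    have h1 : Continuous fun y : TS × XX m => y.2.1 i := (XX_coord i).comp continuous_snd
    have h2 : Continuous fun y : TS × XX m => y.1.2.1 := by fun_prop
    have h3 : Continuous fun y : TS × XX m => y.1.1 := by fun_prop
    exact h3.add (h2.mul h1)

theorem TS_comm (a : TS) (z w : FundamentalGroup TS a) : z * w = w * z := by
  obtain ⟨u, rfl⟩ := cls_surj z
  obtain ⟨v, rfl⟩ := cls_surj w
  have ha := a.2.2
  refine cls_comm_of_square ⟨fun x => ((u x.2).1 + (v x.1).1 - a.1,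
    ⟨(u x.2).2.1 * (v x.1).2.1 * a.2.1⁻¹,
      mul_ne_zero (mul_ne_zero (u x.2).2.2 (v x.1).2.2) (inv_ne_zero ha)⟩), ?_⟩ u v ?_ ?_ ?_ ?_
  · have hu : Continuous fun x : I × I => u x.2 := u.continuous.comp continuous_snd
    have hv : Continuous fun x : I × I => v x.1 := v.continuous.comp continuous_fst
    refine ((hu.fst.add hv.fst).sub continuous_const).prodMk (Continuous.subtype_mk ?_ _)
    exact ((continuous_subtype_val.comp hu.snd).mul (continuous_subtype_val.comp hv.snd)).mul continuous_const
  all_goals intro t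
  all_goals refine Prod.ext ?_ (Subtype.ext ?_)
  all_goals simp
  all_goals field_simp

theorem XX_conf {m : ℕ} (x : XX m) (p : Conf (m+2)) :
    Nonempty (FundamentalGroup (XX m) x ≃*
      FundamentalGroup (Conf (m+2)) p ⧸ Subgroup.center (FundamentalGroup (Conf (m+2)) p)) := by
  have := XX_pc m
  obtain ⟨E⟩ := pi1_homeo (confHomeo m) (confHomeo m p)
  rw [Homeomorph.symm_apply_apply] at E
  obtain ⟨E2⟩ := quot_center_congr E
  obtain ⟨E3⟩ := prod_mod_center (confHomeo m p).1 (confHomeo m p).2 (TS_comm _) (XX_center m _)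
  exact ⟨((FundamentalGroup.fundamentalGroupMulEquivOfPathConnected _ _).trans E3).trans E2⟩

end PBraid

open scoped unitInterval Topology
namespace PBraid

/-- shear -/
noncomputable def shF {m : ℕ} (a c : ℝ) (z : Fin (m+2) → ℂ) : Fin (m+2) → ℂ :=
  fun i => ⟨(z i).re + a * (z i).im, c * (z i).im⟩

theorem shF_inj {m : ℕ} (a c : ℝ) (hc : 0 < c) {z : Fin (m+2) → ℂ} (hz : Function.Injective z) :
    Function.Injective (shF a c z) := by
  intro i j h
  have h1 := congrArg Complex.re h
  have h2 := congrArg Complex.im h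
  simp only [shF] at h1 h2
  have h3 := mul_left_cancel₀ hc.ne' h2
  rw [h3] at h1
  exact hz (Complex.ext (add_right_cancel h1) h3)

/-- shear on normalized configurations -/
noncomputable def shE {m : ℕ} (a c : ℝ) (hc : 0 < c) (w : EE m) : EE m :=
  ⟨⟨shF a c w.1.1, shF_inj a c hc w.1.2.1,
    by apply Complex.ext <;> simp [shF, w.1.2.2.1], by apply Complex.ext <;> simp [shF, w.1.2.2.2]⟩, by
    intro h
    apply w.2
    funext j
    have := congrFun h j
    simp only [imX, shF, Pi.zero_apply] at this ⊢
    exact (mul_eq_zero.1 this).resolve_left hc.ne'⟩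

/-- squared norm of imaginary parts -/
noncomputable def QQ {m : ℕ} (w : EE m) : ℝ := ∑ i, (w.1.1 i).im ^ 2
/-- pairing -/
noncomputable def BB {m : ℕ} (w : EE m) : ℝ := ∑ i, (w.1.1 i).re * (w.1.1 i).im

theorem EE_coord {m : ℕ} (i) : Continuous fun w : EE m => w.1.1 i :=
  (XX_coord i).comp continuous_subtype_val

theorem QQ_cont {m : ℕ} : Continuous (QQ (m := m)) :=
  continuous_finsetSum _ fun i _ => (Complex.continuous_im.comp (EE_coord i)).pow 2

theorem BB_cont {m : ℕ} : Continuous (BB (m := m)) :=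
  continuous_finsetSum _ fun i _ =>
    (Complex.continuous_re.comp (EE_coord i)).mul (Complex.continuous_im.comp (EE_coord i))

theorem QQ_pos {m : ℕ} (w : EE m) : 0 < QQ w := by
  obtain ⟨j, hj⟩ := Function.ne_iff.1 w.2
  refine Finset.sum_pos' (fun i _ => sq_nonneg _) ⟨j.succ.succ, Finset.mem_univ _, ?_⟩
  have : (w.1.1 j.succ.succ).im ≠ 0 := hj
  positivity

theorem cpos {m : ℕ} (t : I) (w : EE m) : 0 < (1 - (t : ℝ)) + t / √(QQ w) := by
  have h := Real.sqrt_pos.2 (QQ_pos w)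
  rcases eq_or_ne (t : ℝ) 1 with h1 | h1
  · rw [h1]; positivity
  · have h2 : 0 < 1 - (t : ℝ) := by
      have := lt_of_le_of_ne t.2.2 h1
      linarith
    have := t.2.1
    positivity

/-- normalizing homotopy -/
noncomputable def NN {m : ℕ} (t : I) (w : EE m) : EE m :=
  shE (-(t * (BB w / QQ w))) ((1 - (t : ℝ)) + t / √(QQ w)) (cpos t w) w

theorem NN_cont {m : ℕ} : Continuous fun x : I × EE m => NN x.1 x.2 := by
  have hQ : Continuous fun x : I × EE m => QQ x.2 := QQ_cont.comp continuous_snd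
  have hB : Continuous fun x : I × EE m => BB x.2 := BB_cont.comp continuous_snd
  have ht : Continuous fun x : I × EE m => (x.1 : ℝ) := continuous_subtype_val.comp continuous_fst
  have hQ0 : ∀ x : I × EE m, QQ x.2 ≠ 0 := fun x => (QQ_pos x.2).ne'
  have hsQ0 : ∀ x : I × EE m, √(QQ x.2) ≠ 0 := fun x => (Real.sqrt_pos.2 (QQ_pos x.2)).ne'
  refine Continuous.subtype_mk (Continuous.subtype_mk (continuous_pi fun i => ?_) _) _
  have hre : Continuous fun x : I × EE m => (x.2.1.1 i).re :=
    Complex.continuous_re.comp ((EE_coord i).comp continuous_snd)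
  have him : Continuous fun x : I × EE m => (x.2.1.1 i).im :=
    Complex.continuous_im.comp ((EE_coord i).comp continuous_snd)
  have e : (fun x : I × EE m => shF (-((x.1 : ℝ) * (BB x.2 / QQ x.2)))
      ((1 - (x.1 : ℝ)) + x.1 / √(QQ x.2)) x.2.1.1 i) = fun x =>
      (((x.2.1.1 i).re + (-((x.1 : ℝ) * (BB x.2 / QQ x.2))) * (x.2.1.1 i).im : ℝ) : ℂ) + 
      ((((1 - (x.1 : ℝ)) + x.1 / √(QQ x.2)) * (x.2.1.1 i).im : ℝ) : ℂ) * Complex.I := by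
    funext x
    apply Complex.ext <;> simp [shF]
  change Continuous (fun x : I × EE m => shF (-((x.1 : ℝ) * (BB x.2 / QQ x.2)))
      ((1 - (x.1 : ℝ)) + x.1 / √(QQ x.2)) x.2.1.1 i)
  rw [e]
  refine (Complex.continuous_ofReal.comp ?_).add ((Complex.continuous_ofReal.comp ?_).mul continuous_const)
  · exact hre.add ((ht.mul (hB.div hQ hQ0)).neg.mul him)
  · exact ((continuous_const.sub ht).add (ht.div hQ.sqrt hsQ0)).mul him

theorem NN_zero {m : ℕ} (w : EE m) : NN 0 w = w := by
  refine Subtype.ext (Subtype.ext (funext fun i => ?_))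
  apply Complex.ext <;> simp [NN, shE, shF]

theorem QQ_sh {m : ℕ} (a c : ℝ) (hc : 0 < c) (w : EE m) : QQ (shE a c hc w) = c ^ 2 * QQ w := by
  simp only [QQ, shE, shF, Finset.mul_sum]
  exact Finset.sum_congr rfl fun i _ => by ring

theorem BB_sh {m : ℕ} (a c : ℝ) (hc : 0 < c) (w : EE m) :
    BB (shE a c hc w) = c * (BB w + a * QQ w) := by
  simp only [BB, QQ, shE, shF, Finset.mul_sum, ← Finset.sum_add_distrib]
  exact Finset.sum_congr rfl fun i _ => by ring

theorem NN_sh {m : ℕ} (a c : ℝ) (hc : 0 < c) (w : EE m) : NN 1 (shE a c hc w) = NN 1 w := by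
  refine Subtype.ext (Subtype.ext (funext fun i => ?_))
  have hQ := QQ_pos w
  have hs : √(QQ (shE a c hc w)) = c * √(QQ w) := by
    rw [QQ_sh, Real.sqrt_mul (by positivity), Real.sqrt_sq hc.le]
  have hsp := Real.sqrt_pos.2 hQ
  apply Complex.ext
  · change ((w.1.1 i).re + a * (w.1.1 i).im) + -(((1 : I) : ℝ) * (BB (shE a c hc w) / QQ (shE a c hc w)))
       * (c * (w.1.1 i).im) = (w.1.1 i).re + -(((1 : I) : ℝ) * (BB w / QQ w)) * (w.1.1 i).im
    rw [QQ_sh, BB_sh]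
    simp only [Set.Icc.coe_one]
    field_simp
    ring
  · change (1 - ((1 : I) : ℝ) + ((1 : I) : ℝ) / √(QQ (shE a c hc w))) * (c * (w.1.1 i).im) =
      (1 - ((1 : I) : ℝ) + ((1 : I) : ℝ) / √(QQ w)) * (w.1.1 i).im
    rw [hs]
    simp only [Set.Icc.coe_one]
    field_simp
    ring

theorem span_im {m : ℕ} (p : SpanConf (m+2)) : imX (nrm p.1 p.2.1) ≠ 0 := by
  intro h
  have hu := toC_sub_ne p.2.1
  set u := toC (p.1 1) - toC (p.1 0) with hu'
  have key : ∀ v : Plane, ((toC v - toC (p.1 0)) / u).im = 0 := by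
    intro v
    have hv : v ∈ affineSpan ℝ (Set.range p.1) := by rw [p.2.2]; trivial
    refine affineSpan_induction (p := fun v => ((toC v - toC (p.1 0)) / u).im = 0) hv ?_ ?_
    · rintro _ ⟨i, rfl⟩
      refine Fin.cases ?_ (fun i => Fin.cases ?_ (fun i => ?_) i) i
      · simp
      · change ((toC (p.1 1) - toC (p.1 0)) / u).im = 0
        rw [← hu', div_self hu]; simp
      · exact congrFun h i
    · intro c x y z hx hy hz
      have e : (toC (c • (x -ᵥ y) +ᵥ z) - toC (p.1 0)) / u =
          (c : ℂ) * ((toC x - toC (p.1 0)) / u - (toC y - toC (p.1 0)) / u) + (toC z - toC (p.1 0)) / u := by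
        have : toC (c • (x -ᵥ y) +ᵥ z) = (c : ℂ) * (toC x - toC y) + toC z := by
          apply Complex.ext <;> simp [toC]
        rw [this]; field_simp; ring
      rw [e]
      simp [hx, hy, hz]
  have := key (ofC (toC (p.1 0) + Complex.I * u))
  rw [toC_ofC, add_sub_cancel_left, mul_div_cancel_right₀ _ hu] at this
  simp at this

theorem EE_span {m : ℕ} (w : EE m) : affineSpan ℝ (Set.range fun i => ofC (w.1.1 i)) = ⊤ := by
  rw [eq_top_iff]
  intro v _
  obtain ⟨j, hj⟩ := Function.ne_iff.1 w.2
  have hj' : (w.1.1 j.succ.succ).im ≠ 0 := hj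
  have hm : ∀ i, ofC (w.1.1 i) ∈ affineSpan ℝ (Set.range fun i => ofC (w.1.1 i)) := fun i =>
    subset_affineSpan _ _ ⟨i, rfl⟩
  set s := affineSpan ℝ (Set.range fun i => ofC (w.1.1 i))
  set z := w.1.1 j.succ.succ with hz
  have h1 := s.smul_vsub_vadd_mem (v 0 - v 1 / z.im * z.re) (hm 1) (hm 0) (hm 0)
  have h2 := s.smul_vsub_vadd_mem (v 1 / z.im) (hm j.succ.succ) (hm 0) h1
  convert h2 using 1
  rw [w.1.2.2.1, w.1.2.2.2, ← hz]
  funext i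
  fin_cases i
  · simp [ofC]
  · simp [ofC]; field_simp

/-- section -/
noncomputable def iotaE {m : ℕ} (w : EE m) : SpanConf (m+2) :=
  ⟨fun i => ofC (w.1.1 i), fun _ _ h => w.1.2.1 (ofC_inj h), EE_span w⟩

theorem iotaE_cont {m : ℕ} : Continuous (iotaE (m := m)) :=
  Continuous.subtype_mk (continuous_pi fun i => ofC_cont.comp (EE_coord i)) _

/-- normalization of a spanning configuration -/
noncomputable def nrmE {m : ℕ} (p : SpanConf (m+2)) : EE m := ⟨nrm p.1 p.2.1, span_im p⟩

theorem nrmE_cont {m : ℕ} : Continuous (nrmE (m := m)) := by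
  have hc : ∀ i, Continuous fun p : SpanConf (m+2) => toC (p.1 i) := fun i =>
    toC_cont.comp ((continuous_apply i).comp continuous_subtype_val)
  refine Continuous.subtype_mk (Continuous.subtype_mk ?_ _) _
  exact continuous_pi fun i => ((hc i).sub (hc 0)).div ((hc 1).sub (hc 0)) fun p => toC_sub_ne p.2.1

theorem nrmE_iotaE {m : ℕ} (w : EE m) : nrmE (iotaE w) = w := by
  refine Subtype.ext (Subtype.ext (funext fun i => ?_))
  simp [nrmE, nrm, iotaE, w.1.2.2.1, w.1.2.2.2]

theorem rel_sh {m : ℕ} (a c : ℝ) (hc : 0 < c) (w : EE m) :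
    affRel (m+2) (iotaE w) (iotaE (shE a c hc w)) := by
  refine ⟨⟨!![1, a; 0, c], 0, by simp [Matrix.det_fin_two, hc]⟩, fun i => ?_⟩
  funext j
  fin_cases j <;> simp [AffP.app, iotaE, shE, shF, ofC] <;> ring

theorem rel_nrm {m : ℕ} (p : SpanConf (m+2)) : affRel (m+2) p (iotaE (nrmE p)) := by
  have hu := toC_sub_ne p.2.1
  set u := toC (p.1 1) - toC (p.1 0) with hu'
  let v := u⁻¹
  have hv : v ≠ 0 := inv_ne_zero hu
  refine ⟨⟨!![v.re, -v.im; v.im, v.re], ofC (-toC (p.1 0) * v), ?_⟩, fun i => ?_⟩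
  · have := Complex.normSq_pos.2 hv
    rw [Complex.normSq_apply] at this
    simp [Matrix.det_fin_two]; linarith
  · apply toC_inj
    have e : toC ((iotaE (nrmE p)).1 i) = (toC (p.1 i) - toC (p.1 0)) * v := by
      change toC (ofC ((toC (p.1 i) - toC (p.1 0)) / u)) = _
      rw [toC_ofC, div_eq_mul_inv]
    rw [e]
    apply Complex.ext <;>
      simp [AffP.app, toC, ofC, Matrix.mulVec, dotProduct, Fin.sum_univ_two] <;> ring

theorem nrm_rel {m : ℕ} (p q : SpanConf (m+2)) (h : affRel (m+2) p q) :
    ∃ a c, ∃ hc : 0 < c, nrmE q = shE a c hc (nrmE p) := by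
  obtain ⟨⟨A, b, hA⟩, h⟩ := h
  have hu := toC_sub_ne p.2.1
  have hu2 := toC_sub_ne q.2.1
  let L : ℂ → ℂ := fun z => ⟨A 0 0 * z.re + A 0 1 * z.im, A 1 0 * z.re + A 1 1 * z.im⟩
  have hL : ∀ i, toC (q.1 i) - toC (q.1 0) = L (toC (p.1 i) - toC (p.1 0)) := by
    intro i
    rw [← h i, ← h 0]
    apply Complex.ext <;>
      simp [L, AffP.app, toC, Matrix.mulVec, dotProduct, Fin.sum_univ_two] <;> ring
  have hL1 := hL 1
  set u := toC (p.1 1) - toC (p.1 0) with hu'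
  set u2 := toC (q.1 1) - toC (q.1 0) with hu2'
  let τ := L (Complex.I * u) / u2
  have hc : 0 < τ.im := by
    have h1 : τ.im = (A.det * Complex.normSq u) / Complex.normSq u2 := by
      simp only [τ, Complex.div_im]
      rw [hL1]
      simp [L, Matrix.det_fin_two, Complex.normSq_apply]
      ring
    rw [h1]
    have := Complex.normSq_pos.2 hu
    have := Complex.normSq_pos.2 hu2
    positivity
  refine ⟨τ.re, τ.im, hc, Subtype.ext (Subtype.ext (funext fun i => ?_))⟩
  change (toC (q.1 i) - toC (q.1 0)) / u2 = ⟨((toC (p.1 i) - toC (p.1 0)) / u).re +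
    τ.re * ((toC (p.1 i) - toC (p.1 0)) / u).im, τ.im * ((toC (p.1 i) - toC (p.1 0)) / u).im⟩
  rw [hL i]
  set z := (toC (p.1 i) - toC (p.1 0)) / u with hz
  have hz' : toC (p.1 i) - toC (p.1 0) = u * z := by rw [hz]; field_simp
  rw [hz']
  have e1 : L (u * z) = z.re * L u + z.im * L (Complex.I * u) := by
    apply Complex.ext <;> simp [L] <;> ring
  have e2 : (⟨z.re + τ.re * z.im, τ.im * z.im⟩ : ℂ) = z.re + z.im * τ := by
    apply Complex.ext <;> simp <;> ring
  rw [e1, e2, ← hL1]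
  simp only [τ]
  field_simp

/-- the projection -/
noncomputable def qE (m : ℕ) : C(EE m, AffConf (m+2)) :=
  ⟨fun w => Quot.mk _ (iotaE w), continuous_quot_mk.comp iotaE_cont⟩

/-- the normal form -/
noncomputable def rE (m : ℕ) : C(AffConf (m+2), EE m) :=
  ⟨Quot.lift (fun p => NN 1 (nrmE p)) (fun p q h => by
    obtain ⟨a, c, hc, e⟩ := nrm_rel p q h
    simp only [e, NN_sh]), 
   continuous_quot_lift _ (NN_cont.comp (continuous_const.prodMk nrmE_cont))⟩

theorem qE_rE {m : ℕ} (y : AffConf (m+2)) : qE m (rE m y) = y := by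
  induction y using Quot.ind with
  | _ p =>
    change Quot.mk _ (iotaE (NN 1 (nrmE p))) = Quot.mk _ p
    exact ((Quot.sound (rel_nrm p)).trans (Quot.sound (rel_sh _ _ _ _))).symm

theorem rE_qE (m : ℕ) : ((rE m).comp (qE m)).Homotopic (.id _) := by
  symm
  refine ⟨{ toFun := fun x => NN x.1 x.2, continuous_toFun := NN_cont, 
            map_zero_left := fun w => NN_zero w, map_one_left := fun w => ?_ }⟩
  change NN 1 w = NN 1 (nrmE (iotaE w))
  rw [nrmE_iotaE]

theorem main (m : ℕ) (hm : 3 ≤ m) (a : AffConf (m+2)) (p : Conf (m+2)) :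
    Nonempty (FundamentalGroup (AffConf (m+2)) a ≃*
      FundamentalGroup (Conf (m+2)) p ⧸ Subgroup.center (FundamentalGroup (Conf (m+2)) p)) := by
  obtain ⟨E1⟩ := pi1_equiv_of_retract (qE m) (rE m) qE_rE (rE_qE m) a
  obtain ⟨E2⟩ := EE_pi1 hm (rE m a)
  obtain ⟨E3⟩ := XX_conf (incE m (rE m a)) p
  exact ⟨(E1.trans E2).trans E3⟩

end PBraid

/-- For `k ≥ 5`, the fundamental group of `A k` is isomorphic to the quotient of the
fundamental group of `F k` (the pure braid group `P k`) by its center (`Z k`). -/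
theorem fundamentalGroup_affConf_iso_pureBraid_mod_center :
    ∀ k : ℕ, 5 ≤ k → ∀ (a : AffConf k) (p : Conf k),
      Nonempty (FundamentalGroup (AffConf k) a ≃*
        FundamentalGroup (Conf k) p ⧸ Subgroup.center (FundamentalGroup (Conf k) p)) := by
  intro k hk
  obtain ⟨m, rfl⟩ : ∃ m, k = m + 2 := ⟨k - 2, by omega⟩
  exact PBraid.main m (by omega)
end

section
/- The fundamental group of A_4, the space of oriented affine configurations of 4 distinct points in the real plane, is isomorphic to the free group on 11 generators. -/
open Matrix

/-- `E 4`: injective 4-tuples of points affinely spanning the plane. -/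
abbrev SpanConf4 : Type :=
  {p : Fin 4 → Plane // Function.Injective p ∧ affineSpan ℝ (Set.range p) = ⊤}

/-- The orbit relation of the componentwise action of `Aff₊(ℝ²)` on `E 4`. -/
def affRel4 (p q : SpanConf4) : Prop :=
  ∃ g : AffP, ∀ i : Fin 4, g.app (p.1 i) = q.1 i

/-- `A 4 = E 4 / Aff₊(ℝ²)`: the space of oriented affine configurations of `4` distinct
points in the real plane, with the quotient topology. -/
abbrev AffConf4 : Type := Quot affRel4

open Topology

theorem vk_homotopic_of_mem {X : Type*} [TopologicalSpace X] {S : Set X} (hS : IsSimplyConnected S)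
    {x y : X} (γ γ' : Path x y) (h : ∀ t, γ t ∈ S) (h' : ∀ t, γ' t ∈ S) :
    Path.Homotopic.Quotient.mk γ = Path.Homotopic.Quotient.mk γ' := by
  have := hS.simplyConnectedSpace
  have hx : x ∈ S := by simpa using h 0
  have hy : y ∈ S := by simpa using h 1
  let a : Path (⟨x, hx⟩ : S) ⟨y, hy⟩ :=
    ⟨⟨fun t => ⟨γ t, h t⟩, by fun_prop⟩, by simp, by simp⟩
  let b : Path (⟨x, hx⟩ : S) ⟨y, hy⟩ :=
    ⟨⟨fun t => ⟨γ' t, h' t⟩, by fun_prop⟩, by simp, by simp⟩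
  have hab : a.Homotopic b := SimplyConnectedSpace.paths_homotopic a b
  have := hab.map (⟨Subtype.val, continuous_subtype_val⟩ : C(S, X))
  exact Path.Homotopic.Quotient.eq.2 this

theorem vk_path_induct {X : Type*} [TopologicalSpace X] {U V : Set X} (hU : IsOpen U)
    (hV : IsOpen V) (hUV : ∀ x, x ∈ U ∨ x ∈ V)
    (P : ∀ x y : X, Path.Homotopic.Quotient x y → Prop)
    (htrans : ∀ x y z (p : Path.Homotopic.Quotient x y) (q : Path.Homotopic.Quotient y z), P x y p → P y z q → P x z (p.trans q))
    (PU : ∀ x y (γ : Path x y), (∀ t, γ t ∈ U) → P x y (Path.Homotopic.Quotient.mk γ))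
    (PV : ∀ x y (γ : Path x y), (∀ t, γ t ∈ V) → P x y (Path.Homotopic.Quotient.mk γ))
    (x y : X) (q : Path.Homotopic.Quotient x y) : P x y q := by
  obtain ⟨γ⟩ := q
  obtain ⟨t, t_0, t_mono, ⟨n_max, h_max⟩, t_sub⟩ :=
    exists_monotone_Icc_subset_open_cover_unitInterval
    (c := fun i : Bool => γ ⁻¹' (if i then U else V))
    (fun i => by
      cases i
      · simpa using hV.preimage γ.continuous
      · simpa using hU.preimage γ.continuous)
    (fun t _ ↦ Set.mem_iUnion.2 (by
      rcases hUV (γ t) with h | h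
      · exact ⟨true, by simpa using h⟩
      · exact ⟨false, by simpa using h⟩))
  have key : ∀ n, P _ _ (Path.Homotopic.Quotient.mk (γ.subpath 0 (t n))) := by
    intro n
    induction n with
    | zero =>
      rw [t_0, Path.subpath_self]
      rcases hUV (γ 0) with h | h
      · exact PU _ _ _ (fun _ => h)
      · exact PV _ _ _ (fun _ => h)
    | succ n ih =>
      have e : Path.Homotopic.Quotient.mk (γ.subpath 0 (t (n+1))) =
          (Path.Homotopic.Quotient.mk (γ.subpath 0 (t n))).trans (Path.Homotopic.Quotient.mk (γ.subpath (t n) (t (n+1)))) := by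
        rw [← Path.Homotopic.Quotient.mk_trans]
        exact (Path.Homotopic.Quotient.eq.2 ⟨Path.Homotopy.subpathTransSubpath γ _ _ _⟩).symm
      rw [e]
      refine htrans _ _ _ _ _ ih ?_
      obtain ⟨i, hi⟩ := t_sub n
      have hr : ∀ s, γ.subpath (t n) (t (n+1)) s ∈ (if i then U else V) := by
        intro s
        have : γ.subpath (t n) (t (n+1)) s ∈ Set.range (γ.subpath (t n) (t (n+1))) := ⟨s, rfl⟩
        rw [Path.range_subpath_of_le _ _ _ (t_mono n.le_succ)] at this
        obtain ⟨u, hu, hus⟩ := this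
        rw [← hus]
        exact hi hu
      cases i
      · exact PV _ _ _ (by simpa using hr)
      · exact PU _ _ _ (by simpa using hr)
  have h1 := key n_max
  rw [h_max _ le_rfl, Path.subpath_zero_one] at h1
  have fin : ∀ x' y' (hx : x' = x) (hy : y' = y), P x' y' (Path.Homotopic.Quotient.mk (γ.cast hx hy)) →
      P x y (Path.Homotopic.Quotient.mk γ) := by
    rintro _ _ rfl rfl h
    exact h
  exact fin _ _ _ _ h1

/-- The fibre bundle core for a two-set cover with transition function `g`. -/
noncomputable def vkCore {X : Type*} [TopologicalSpace X] {G : Type*} [Group G] [TopologicalSpace G]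
    [DiscreteTopology G] (U V : Set X) (hU : IsOpen U) (hV : IsOpen V)
    (hUV : ∀ x, x ∈ U ∨ x ∈ V) (g : X → G)
    (hg : ∀ x ∈ U ∩ V, ∀ᶠ y in 𝓝 x, g y = g x) : FiberBundleCore Prop X G := by
  classical
  let h : Prop → X → G := fun i x => if i then 1 else g x
  exact
  { baseSet := fun i => if i then U else V
    isOpen_baseSet := fun i => by split_ifs <;> assumption
    indexAt := fun x => x ∈ U
    mem_baseSet_at := fun x => by
      by_cases hx : x ∈ U
      · simp [hx]
      · simpa [hx] using (hUV x).resolve_left hx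
    coordChange := fun i j x v => h j x * (h i x)⁻¹ * v
    coordChange_self := fun i x _ v => by simp
    continuousOn_coordChange := fun i j => by
      have hl : ∀ i j : Prop, ∀ x ∈ (if i then U else V) ∩ (if j then U else V),
          ∀ᶠ y in 𝓝 x, h j y * (h i y)⁻¹ = h j x * (h i x)⁻¹ := by
        intro i j x hx
        by_cases hi : i <;> by_cases hj : j <;> simp only [hi, hj, if_true, if_false, h] at hx ⊢
        · simp
        · filter_upwards [hg x hx] with y hy; rw [hy]
        · filter_upwards [hg x hx.symm] with y hy; rw [hy]
        · simp
      rintro ⟨x, v⟩ ⟨hx, -⟩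
      apply ContinuousAt.continuousWithinAt
      have : (fun p : X × G => h j p.1 * (h i p.1)⁻¹ * p.2) =ᶠ[𝓝 (x, v)]
          fun p => h j x * (h i x)⁻¹ * p.2 := by
        have := (continuous_fst (X := X) (Y := G)).continuousAt (x := (x, v)) |>.eventually
          (hl i j x hx)
        filter_upwards [this] with p hp
        rw [hp]
      refine ContinuousAt.congr ?_ this.symm
      exact (continuous_of_discreteTopology (f := fun w : G => h j x * (h i x)⁻¹ * w)).continuousAt.comp
        continuous_snd.continuousAt
    coordChange_comp := fun i j k x _ v => by group }

theorem vkCore_cov {X : Type*} [TopologicalSpace X] {ι G : Type*} [TopologicalSpace G]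
    [DiscreteTopology G] (Z : FiberBundleCore ι X G) : IsCoveringMap Z.proj :=
  IsFiberBundle.isCoveringMap fun x => ⟨Z.localTrivAt x, Z.mem_localTrivAt_baseSet x⟩

theorem vkCore_monodromy {X : Type*} [TopologicalSpace X] {ι G : Type*} [TopologicalSpace G]
    [DiscreteTopology G] (Z : FiberBundleCore ι X G) (i : ι) {x y : X} (γ : Path x y)
    (hγ : ∀ t, γ t ∈ Z.baseSet i) (v w v' : G) (hv : Z.coordChange i (Z.indexAt x) x w = v)
    (hv' : Z.coordChange i (Z.indexAt y) y w = v') :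
    (vkCore_cov Z).monodromy (Path.Homotopic.Quotient.mk γ) ⟨⟨x, v⟩, rfl⟩ = ⟨⟨y, v'⟩, rfl⟩ := by
  have e : ∀ z y : X, z = y → ∀ {u : G}, Z.coordChange i (Z.indexAt z) z w = u →
      (⟨y, Z.coordChange i (Z.indexAt y) y w⟩ : Z.TotalSpace) = ⟨z, u⟩ := by
    rintro z _ rfl u rfl
    rfl
  have key := ((vkCore_cov Z).eq_liftPath_iff (γ := (γ : C(unitInterval, X)))
    (e := (⟨x, v⟩ : Z.TotalSpace)) γ.source
    (Γ := fun t => (⟨γ t, Z.coordChange i (Z.indexAt (γ t)) (γ t) w⟩ : Z.TotalSpace))).2 ?_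
  · apply Subtype.ext
    have := congr_fun key 1
    exact this.symm.trans (e _ _ γ.target.symm hv')
  · refine ⟨?_, rfl, e _ _ γ.source.symm hv⟩
    have h1 := (Z.localTriv i).continuousOn_invFun
    have h2 : Continuous fun t => (γ t, w) := by fun_prop
    exact h1.comp_continuous h2 (fun t => by
      rw [(Z.localTriv i).target_eq]; exact ⟨hγ t, trivial⟩)

theorem vk_holonomy {X : Type*} [TopologicalSpace X] {G : Type*} [Group G] [TopologicalSpace G]
    [DiscreteTopology G] (U V : Set X) (hU : IsOpen U) (hV : IsOpen V)
    (hUV : ∀ x, x ∈ U ∨ x ∈ V) (g : X → G)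
    (hg : ∀ x ∈ U ∩ V, ∀ᶠ y in 𝓝 x, g y = g x) {x b : X} (hx : g x = 1)
    (c d : Path x b) (hc : ∀ t, c t ∈ U) (hd : ∀ t, d t ∈ V) (v : G) :
    (vkCore_cov (vkCore U V hU hV hUV g hg)).monodromy
      ((Path.Homotopic.Quotient.mk c).trans (Path.Homotopic.Quotient.mk d).symm) ⟨⟨x, v⟩, rfl⟩
      = ⟨⟨x, g b * v⟩, rfl⟩ := by
  have hxU : x ∈ U := by simpa using hc 0
  have hbU : b ∈ U := by simpa using hc 1
  rw [IsCoveringMap.monodromy_trans_apply]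
  rw [vkCore_monodromy (vkCore U V hU hV hUV g hg) True c (fun t => by simpa only [vkCore, if_true] using hc t) v v v
    (by simp [vkCore, hxU]) (by simp [vkCore, hbU])]
  rw [← Path.Homotopic.Quotient.mk_symm]
  exact vkCore_monodromy (vkCore U V hU hV hUV g hg) False d.symm
    (fun t => by
      simp only [vkCore, if_false]
      exact hd (unitInterval.symm t)) v (g b * v) (g b * v)
    (by simp [vkCore, hbU]) (by simp [vkCore, hxU, hx])

section
open CategoryTheory

theorem vk_gpd₁ {C : Type*} [Groupoid C] {X Y Z : C} (a c : X ⟶ Y) (j : Y ⟶ Z) :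
    a ≫ Groupoid.inv c = (a ≫ j) ≫ Groupoid.inv (c ≫ j) := by
  simp

theorem vk_gpd₂ {C : Type*} [Groupoid C] {O X Y Z : C} (a : O ⟶ X) (b : O ⟶ Y) (c : O ⟶ Z)
    (p : X ⟶ Y) (q : Y ⟶ Z) : a ≫ (p ≫ q) ≫ Groupoid.inv c =
      (a ≫ p ≫ Groupoid.inv b) ≫ (b ≫ q ≫ Groupoid.inv c) := by
  simp

theorem vk_gpd₃ {C : Type*} [Groupoid C] {O X Y : C} (a : O ⟶ X) (p : X ⟶ Y) :
    a ≫ p ≫ Groupoid.inv (a ≫ p) = 𝟙 O := by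
  simp

theorem vk_gpd₄ {C : Type*} [Groupoid C] {O X Y : C} (a d : O ⟶ X) (p : X ⟶ Y) (b : O ⟶ Y) :
    a ≫ p ≫ Groupoid.inv b =
      (a ≫ Groupoid.inv d) ≫ Groupoid.inv (b ≫ Groupoid.inv (d ≫ p)) := by
  simp

theorem vk_gpd₅ {C : Type*} [Groupoid C] {X : C} (p : X ⟶ X) :
    p = 𝟙 X ≫ p ≫ Groupoid.inv (𝟙 X) := by
  simp

end

theorem vk_main {X : Type*} [TopologicalSpace X] {ι : Type*} (U V : Set X) (hU : IsOpen U)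
    (hV : IsOpen V) (hUV : ∀ x, x ∈ U ∨ x ∈ V) (sU : IsSimplyConnected U)
    (sV : IsSimplyConnected V) (κ : X → Option ι)
    (hκ : ∀ x ∈ U ∩ V, ∀ᶠ y in 𝓝 x, κ y = κ x)
    (hj : ∀ x ∈ U ∩ V, ∀ y ∈ U ∩ V, κ x = κ y → JoinedIn (U ∩ V) x y)
    (b : Option ι → X) (hb : ∀ i, b i ∈ U ∩ V) (hκb : ∀ i, κ (b i) = i) :
    Nonempty (FundamentalGroup X (b none) ≃* FreeGroup ι) := by
  classical
  set x₀ := b none with hx₀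
  have h0 : x₀ ∈ U ∩ V := hb none
  -- paths in `U` and `V` from the base point
  have exU : ∀ x ∈ U, JoinedIn U x₀ x := fun x hx => sU.isPathConnected.joinedIn _ h0.1 _ hx
  have exV : ∀ x ∈ V, JoinedIn V x₀ x := fun x hx => sV.isPathConnected.joinedIn _ h0.2 _ hx
  let cU : ∀ x ∈ U, Path x₀ x := fun x hx => (exU x hx).somePath
  let cV : ∀ x ∈ V, Path x₀ x := fun x hx => (exV x hx).somePath
  have cUm : ∀ x hx t, cU x hx t ∈ U := fun x hx t => (exU x hx).somePath_mem t
  have cVm : ∀ x hx t, cV x hx t ∈ V := fun x hx t => (exV x hx).somePath_mem t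
  let loop : ∀ x, x ∈ U ∩ V → FundamentalGroup X x₀ := fun x hx =>
    (Path.Homotopic.Quotient.mk (cU x hx.1)).trans (Path.Homotopic.Quotient.mk (cV x hx.2)).symm
  let Ψ : FreeGroup ι →* FundamentalGroup X x₀ :=
    FreeGroup.lift (fun i => loop (b (some i)) (hb _))
  let g : X → FreeGroup ι := fun x => (κ x).elim 1 FreeGroup.of
  have hg : ∀ x ∈ U ∩ V, ∀ᶠ y in 𝓝 x, g y = g x := fun x hx => by
    filter_upwards [hκ x hx] with y hy
    simp only [g, hy]
  have hg0 : g x₀ = 1 := by simp [g, hx₀, hκb]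
  -- injectivity via monodromy
  have inj : Function.Injective Ψ := by
    let _ : TopologicalSpace (FreeGroup ι) := ⊥
    have : DiscreteTopology (FreeGroup ι) := ⟨rfl⟩
    let Z := vkCore U V hU hV hUV g hg
    let ρ := (vkCore_cov Z).monodromyPerm x₀
    let pt : FreeGroup ι → (Z.proj ⁻¹' {x₀}) := fun v => ⟨⟨x₀, v⟩, rfl⟩
    have hgen : ∀ i v, ρ (loop (b (some i)) (hb _)) (pt v) = pt (FreeGroup.of i * v) := by
      intro i v
      have := vk_holonomy U V hU hV hUV g hg hg0 (cU _ (hb (some i)).1) (cV _ (hb (some i)).2)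
        (cUm _ (hb (some i)).1) (cVm _ (hb (some i)).2) v
      have e : g (b (some i)) = FreeGroup.of i := by simp [g, hκb]
      rw [e] at this
      exact this
    have key : ∀ w v, ρ (Ψ w) (pt v) = pt (w * v) := by
      intro w
      induction w using FreeGroup.induction_on with
      | C1 => intro v; rw [map_one, map_one, one_mul]; rfl
      | of i => intro v; simpa [Ψ] using hgen i v
      | inv_of i _ =>
        intro v
        rw [map_inv, map_inv, Equiv.Perm.inv_eq_iff_eq]
        simpa [Ψ] using (hgen i ((FreeGroup.of i)⁻¹ * v)).symm
      | mul a c ha hc =>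
        intro v
        rw [map_mul, map_mul, Equiv.Perm.mul_apply, hc, ha, mul_assoc]
    intro w w' hww
    have h1 := key w 1
    rw [hww, key w' 1] at h1
    have h2 := congrArg Subtype.val h1
    have h3 : w' * 1 = w * 1 := eq_of_heq (Bundle.TotalSpace.mk.inj h2).2
    simpa using h3.symm
  -- surjectivity via subdivision
  have surj : Function.Surjective Ψ := by
    rw [← MonoidHom.range_eq_top, eq_top_iff]
    intro q₀ _
    let C : ∀ x, Path.Homotopic.Quotient x₀ x := fun x =>
      if hx : x ∈ U then Path.Homotopic.Quotient.mk (cU x hx)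
      else Path.Homotopic.Quotient.mk (cV x ((hUV x).resolve_left hx))
    have hCU : ∀ x (hx : x ∈ U), C x = Path.Homotopic.Quotient.mk (cU x hx) := fun x hx => by
      simp [C, hx]
    -- loops depend only on the label
    have loop_eq : ∀ x (hx : x ∈ U ∩ V) y (hy : y ∈ U ∩ V), κ x = κ y → loop x hx = loop y hy := by
      intro x hx y hy hxy
      have J := hj x hx y hy hxy
      have a1 : Path.Homotopic.Quotient.mk (cU y hy.1) =
          (Path.Homotopic.Quotient.mk (cU x hx.1)).trans (Path.Homotopic.Quotient.mk J.somePath) := by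
        rw [← Path.Homotopic.Quotient.mk_trans]
        refine vk_homotopic_of_mem sU _ _ (cUm y hy.1) ?_
        intro t
        rw [Path.trans_apply]
        split_ifs
        exacts [cUm x hx.1 _, (J.somePath_mem _).1]
      have a2 : Path.Homotopic.Quotient.mk (cV y hy.2) =
          (Path.Homotopic.Quotient.mk (cV x hx.2)).trans (Path.Homotopic.Quotient.mk J.somePath) := by
        rw [← Path.Homotopic.Quotient.mk_trans]
        refine vk_homotopic_of_mem sV _ _ (cVm y hy.2) ?_
        intro t
        rw [Path.trans_apply]
        split_ifs
        exacts [cVm x hx.2 _, (J.somePath_mem _).2]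
      simp only [loop]
      rw [a1, a2]
      exact (vk_gpd₁ (C := FundamentalGroupoid X) (Path.Homotopic.Quotient.mk (cU x hx.1))
        (Path.Homotopic.Quotient.mk (cV x hx.2)) (Path.Homotopic.Quotient.mk J.somePath))
    have loop_mem : ∀ x (hx : x ∈ U ∩ V), loop x hx ∈ Ψ.range := by
      intro x hx
      rw [loop_eq x hx (b (κ x)) (hb _) (hκb _).symm]
      cases hk : κ x with
      | none =>
        have e : loop (b none) (hb none) = 1 := by
          have a1 : Path.Homotopic.Quotient.mk (cU (b none) (hb none).1) =
              Path.Homotopic.Quotient.refl _ :=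
            vk_homotopic_of_mem sU _ _ (cUm x₀ h0.1) (fun _ => h0.1)
          have a2 : Path.Homotopic.Quotient.mk (cV (b none) (hb none).2) =
              Path.Homotopic.Quotient.refl _ :=
            vk_homotopic_of_mem sV _ _ (cVm x₀ h0.2) (fun _ => h0.2)
          simp only [loop]
          rw [a1, a2]
          exact Path.Homotopic.Quotient.trans_symm _
        rw [e]
        exact one_mem _
      | some i =>
        exact ⟨FreeGroup.of i, by simp [Ψ]⟩
    let P : ∀ x y : X, Path.Homotopic.Quotient x y → Prop := fun x y p =>
      (((C x).trans (p.trans (C y).symm) : Path.Homotopic.Quotient x₀ x₀) :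
        FundamentalGroup X x₀) ∈ Ψ.range
    have tr : ∀ p q : FundamentalGroup X x₀, p = q → q ∈ Ψ.range → p ∈ Ψ.range := by
      rintro _ _ rfl h
      exact h
    have hP : P x₀ x₀ q₀ := by
      refine vk_path_induct hU hV hUV P ?_ ?_ ?_ x₀ x₀ q₀
      · intro x y z p q hp hq
        have := mul_mem hq hp
        simp only [P]
        refine tr _ _ ?_ this
        exact vk_gpd₂ (C := FundamentalGroupoid X) (C x) (C y) (C z) p q
      · intro x y γ hγ
        have hx : x ∈ U := by simpa using hγ 0
        have hy : y ∈ U := by simpa using hγ 1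
        have a1 : C y = (C x).trans (Path.Homotopic.Quotient.mk γ) := by
          rw [hCU x hx, hCU y hy, ← Path.Homotopic.Quotient.mk_trans]
          refine vk_homotopic_of_mem sU _ _ (cUm y hy) ?_
          intro t
          rw [Path.trans_apply]
          split_ifs
          exacts [cUm x hx _, hγ _]
        simp only [P]
        refine tr _ _ ?_ (one_mem _)
        rw [a1]
        exact vk_gpd₃ (C := FundamentalGroupoid X) (C x) (Path.Homotopic.Quotient.mk γ)
      · intro x y γ hγ
        have hx : x ∈ V := by simpa using hγ 0
        have hy : y ∈ V := by simpa using hγ 1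
        have a1 : Path.Homotopic.Quotient.mk (cV y hy) =
            (Path.Homotopic.Quotient.mk (cV x hx)).trans (Path.Homotopic.Quotient.mk γ) := by
          rw [← Path.Homotopic.Quotient.mk_trans]
          refine vk_homotopic_of_mem sV _ _ (cVm y hy) ?_
          intro t
          rw [Path.trans_apply]
          split_ifs
          exacts [cVm x hx _, hγ _]
        have hL : ∀ z (hz : z ∈ V), (((C z).trans (Path.Homotopic.Quotient.mk (cV z hz)).symm :
            Path.Homotopic.Quotient x₀ x₀) : FundamentalGroup X x₀) ∈ Ψ.range := by
          intro z hz
          by_cases hzU : z ∈ U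
          · rw [hCU z hzU]
            exact loop_mem z ⟨hzU, hz⟩
          · have : C z = Path.Homotopic.Quotient.mk (cV z hz) := by simp [C, hzU]
            rw [this]
            refine tr _ _ ?_ (one_mem _)
            exact Path.Homotopic.Quotient.trans_symm _
        have := mul_mem (inv_mem (hL y hy)) (hL x hx)
        simp only [P]
        refine tr _ _ ?_ this
        rw [a1]
        exact vk_gpd₄ (C := FundamentalGroupoid X) (C x) (Path.Homotopic.Quotient.mk (cV x hx))
          (Path.Homotopic.Quotient.mk γ) (C y)
    have hC0 : C x₀ = Path.Homotopic.Quotient.refl x₀ := by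
      rw [hCU x₀ h0.1]
      exact vk_homotopic_of_mem sU _ _ (cUm x₀ h0.1) (fun _ => h0.1)
    simp only [P, hC0] at hP
    refine tr _ _ ?_ hP
    exact vk_gpd₅ (C := FundamentalGroupoid X) (X := ⟨x₀⟩) q₀
  exact ⟨(MulEquiv.ofBijective Ψ ⟨inj, surj⟩).symm⟩

/-- The plane punctured at the points `(a i, b i)`. -/
abbrev PPlane {n : ℕ} (a b : Fin n → ℝ) : Type := {z : ℝ × ℝ // ∀ i, z ≠ (a i, b i)}

/-- The plane with vertical rays removed, downwards for `σ = 1`, upwards for `σ = -1`. -/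
def slitSet {n : ℕ} (a b : Fin n → ℝ) (σ : ℝ) : Set (PPlane a b) :=
  {z | ∀ i, z.1.1 = a i → σ * b i < σ * z.1.2}

/-- Constructor for points of the slit plane. -/
def slitMk {n : ℕ} {a b : Fin n → ℝ} {σ : ℝ} (z : ℝ × ℝ)
    (h : ∀ i, z.1 = a i → σ * b i < σ * z.2) : slitSet a b σ :=
  ⟨⟨z, fun i hi => by
    have := h i (by rw [hi])
    rw [hi] at this
    exact lt_irrefl _ this⟩, h⟩

theorem slitSet_isOpen {n : ℕ} (a b : Fin n → ℝ) (σ : ℝ) : IsOpen (slitSet a b σ) := by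
  have : slitSet a b σ = ⋂ i, {z : PPlane a b | z.1.1 ≠ a i ∨ σ * b i < σ * z.1.2} := by
    ext z
    simp only [slitSet, Set.mem_ofPred_eq, Set.mem_iInter]
    exact forall_congr' fun i => by tauto
  rw [this]
  refine isOpen_iInter_of_finite fun i => ?_
  have h1 : IsOpen {z : PPlane a b | z.1.1 ≠ a i} := isOpen_ne_fun (by fun_prop) (by fun_prop)
  have h2 : IsOpen {z : PPlane a b | σ * b i < σ * z.1.2} :=
    isOpen_lt (by fun_prop) (by fun_prop)
  exact h1.union h2

theorem slitSet_isSimplyConnected {n : ℕ} (a b : Fin n → ℝ) (σ : ℝ) (hσ : σ * σ = 1) :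
    IsSimplyConnected (slitSet a b σ) := by
  obtain ⟨M, hM⟩ : ∃ M, ∀ i, σ * b i < M := by
    obtain ⟨M, hM⟩ := (Set.finite_range fun i => σ * b i).bddAbove
    exact ⟨M + 1, fun i => lt_of_le_of_lt (hM ⟨i, rfl⟩) (by linarith)⟩
  have hσ' : ∀ x : ℝ, σ * (σ * x) = x := fun x => by rw [← mul_assoc, hσ, one_mul]
  have m1 : ∀ (t : unitInterval) (z : slitSet a b σ), ∀ i,
      (z.1.1.1, (1 - (t : ℝ)) * z.1.1.2 + t * (σ * max (σ * z.1.1.2) M)).1 = a i →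
      σ * b i < σ * (z.1.1.1, (1 - (t : ℝ)) * z.1.1.2 + t * (σ * max (σ * z.1.1.2) M)).2 := by
    intro t z i hi
    have h1 := z.2 i hi
    have h2 : σ * ((1 - (t : ℝ)) * z.1.1.2 + t * (σ * max (σ * z.1.1.2) M)) =
      (1 - t) * (σ * z.1.1.2) + t * max (σ * z.1.1.2) M := by
      linear_combination (t * max (σ * z.1.1.2) M) * hσ
    simp only at h1 ⊢
    rw [h2]
    have h3 : (0 : ℝ) ≤ t := t.2.1
    nlinarith [mul_le_mul_of_nonneg_left (le_max_left (σ * z.1.1.2) M) h3]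
  have m2 : ∀ (t : unitInterval) (z : slitSet a b σ), ∀ i,
      ((1 - (t : ℝ)) * z.1.1.1, (1 - (t : ℝ)) * (σ * max (σ * z.1.1.2) M) + t * (σ * M)).1 = a i →
      σ * b i <
      σ * ((1 - (t : ℝ)) * z.1.1.1, (1 - (t : ℝ)) * (σ * max (σ * z.1.1.2) M) + t * (σ * M)).2 := by
    intro t z i _
    have h2 : σ * ((1 - (t : ℝ)) * (σ * max (σ * z.1.1.2) M) + t * (σ * M)) =
      (1 - t) * max (σ * z.1.1.2) M + t * M := by
      linear_combination (t * M + (1 - t) * max (σ * z.1.1.2) M) * hσ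
    simp only
    rw [h2]
    have h3 : (0 : ℝ) ≤ 1 - t := by linarith [t.2.2]
    nlinarith [mul_le_mul_of_nonneg_left (le_max_right (σ * z.1.1.2) M) h3, hM i]
  let push : C(slitSet a b σ, slitSet a b σ) :=
    ⟨fun z => slitMk _ (m1 1 z), by unfold slitMk; fun_prop⟩
  let H1 : (ContinuousMap.id (slitSet a b σ)).Homotopy push :=
    { toFun := fun p => slitMk _ (m1 p.1 p.2)
      continuous_toFun := by unfold slitMk; fun_prop
      map_zero_left := fun z => by
        apply Subtype.ext; apply Subtype.ext
        simp [slitMk]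
      map_one_left := fun z => rfl }
  let base : slitSet a b σ := slitMk (0, σ * M) (fun i _ => by rw [hσ']; exact hM i)
  let H2 : push.Homotopy (ContinuousMap.const _ base) :=
    { toFun := fun p => slitMk _ (m2 p.1 p.2)
      continuous_toFun := by unfold slitMk; fun_prop
      map_zero_left := fun z => by
        apply Subtype.ext; apply Subtype.ext
        simp [slitMk, push]
      map_one_left := fun z => by
        apply Subtype.ext; apply Subtype.ext
        simp [slitMk, base] }
  have : ContractibleSpace (slitSet a b σ) := by
    rw [contractible_iff_id_nullhomotopic]
    exact ⟨base, ⟨H1.trans H2⟩⟩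
  exact SimplyConnectedSpace.ofContractible _

theorem punctured_pi1 {n : ℕ} (a b : Fin n → ℝ) (e : Fin (n + 1) → ℝ)
    (he : ∀ k i, a i < e k ↔ i.val < k.val) (hne : ∀ k i, e k ≠ a i) (x : PPlane a b) :
    Nonempty (FundamentalGroup (PPlane a b) x ≃* FreeGroup (Fin n)) := by
  classical
  have hmem : ∀ z : PPlane a b, z ∈ slitSet a b 1 ∩ slitSet a b (-1) ↔ ∀ i, z.1.1 ≠ a i := by
    intro z
    constructor
    · rintro ⟨h1, h2⟩ i hi
      have := h1 i hi
      have := h2 i hi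
      linarith
    · intro h
      exact ⟨fun i hi => absurd hi (h i), fun i hi => absurd hi (h i)⟩
  have hcov : ∀ z : PPlane a b, z ∈ slitSet a b 1 ∨ z ∈ slitSet a b (-1) := by
    intro z
    by_contra! hcon
    obtain ⟨h1, h2⟩ := hcon
    simp only [slitSet, Set.mem_ofPred_eq, not_forall, not_lt] at h1 h2
    obtain ⟨i, hi, hi'⟩ := h1
    obtain ⟨j, hj, hj'⟩ := h2
    have hu : ∀ i j : Fin n, a i = a j → i ≤ j := by
      intro i j hij
      by_contra! hlt
      have h1 := (he (j.succ) j).2 (by simp)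
      rw [← hij, he] at h1
      simp only [Fin.val_succ] at h1
      have : j.val < i.val := hlt
      omega
    have : i = j := le_antisymm (hu i j (hi ▸ hj)) (hu j i (hj ▸ hi))
    subst this
    exact z.2 i (Prod.ext hi (by simp only at hi' hj' ⊢; linarith))
  let cnt : ℝ → Finset (Fin n) := fun u => Finset.univ.filter (fun i => a i < u)
  have hcard : ∀ u, (cnt u).card < n + 1 := fun u =>
    Nat.lt_succ_of_le ((Finset.card_le_univ _).trans (by simp))
  let κ' : ℝ → Fin (n + 1) := fun u => ⟨(cnt u).card, hcard u⟩
  have hκe : ∀ k, κ' (e k) = k := by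
    intro k
    apply Fin.ext
    simp only [κ', cnt, he]
    have := Fin.card_filter_val_lt (m := k.val) (n := n)
    rw [this]
    have := k.2
    omega
  let bp : Fin (n + 1) → PPlane a b := fun k => ⟨(e k, 0), fun i hi => hne k i (congrArg Prod.fst hi)⟩
  have hbp : ∀ k, bp k ∈ slitSet a b 1 ∩ slitSet a b (-1) := fun k => (hmem _).2 (hne k)
  have main := vk_main (ι := Fin n) (slitSet a b 1) (slitSet a b (-1)) (slitSet_isOpen _ _ _)
    (slitSet_isOpen _ _ _) hcov (slitSet_isSimplyConnected _ _ _ (by norm_num))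
    (slitSet_isSimplyConnected _ _ _ (by norm_num))
    (fun z => finSuccEquiv n (κ' z.1.1)) ?_ ?_ (fun o => bp ((finSuccEquiv n).symm o))
    (fun o => hbp _) (fun o => by simp [bp, hκe])
  · have : PathConnectedSpace (PPlane a b) := by
      rw [pathConnectedSpace_iff_univ]
      have h1 := (slitSet_isSimplyConnected a b 1 (by norm_num)).isPathConnected
      have h2 := (slitSet_isSimplyConnected a b (-1) (by norm_num)).isPathConnected
      have := h1.union h2 ⟨_, hbp 0⟩
      rwa [Set.eq_univ_of_forall (s := slitSet a b 1 ∪ slitSet a b (-1)) hcov] at this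
    obtain ⟨f⟩ := main
    exact ⟨(FundamentalGroup.fundamentalGroupMulEquivOfPathConnected x _).trans f⟩
  · intro z hz
    rw [hmem] at hz
    have hc : Continuous fun w : PPlane a b => w.1.1 := by fun_prop
    have : ∀ᶠ w : PPlane a b in 𝓝 z, ∀ i, (a i < w.1.1 ↔ a i < z.1.1) := by
      rw [Filter.eventually_all]
      intro i
      rcases lt_or_gt_of_ne (hz i) with h | h
      · filter_upwards [hc.continuousAt.eventually (gt_mem_nhds h)] with w hw
        constructor <;> intro h' <;> linarith
      · filter_upwards [hc.continuousAt.eventually (lt_mem_nhds h)] with w hw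
        exact ⟨fun _ => h, fun _ => hw⟩
    filter_upwards [this] with w hw
    simp only [κ', cnt, hw]
  · intro z hz w hw hzw
    rw [hmem] at hz hw
    have h1 : (cnt z.1.1).card = (cnt w.1.1).card := by
      have := (finSuccEquiv n).injective hzw
      simpa [κ'] using this
    have h2 : cnt z.1.1 = cnt w.1.1 := by
      rcases le_total z.1.1 w.1.1 with h | h
      · exact Finset.eq_of_subset_of_card_le
          (Finset.monotone_filter_right _ fun i _ hi => lt_of_lt_of_le hi h) h1.ge
      · exact (Finset.eq_of_subset_of_card_le
          (Finset.monotone_filter_right _ fun i _ hi => lt_of_lt_of_le hi h) h1.le).symm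
    have h3 : ∀ i, a i < z.1.1 ↔ a i < w.1.1 := fun i => by
      have := Finset.ext_iff.1 h2 i
      simpa [cnt] using this
    have h4 : ∀ (t : unitInterval) i, (1 - (t : ℝ)) * z.1.1 + t * w.1.1 ≠ a i := by
      intro t i
      have t0 := t.2.1
      have t1 := t.2.2
      rcases lt_or_gt_of_ne (hz i) with h | h
      · have h' : w.1.1 < a i := lt_of_le_of_ne (not_lt.1 fun h' => by linarith [(h3 i).2 h']) (hw i)
        apply ne_of_lt
        rcases t0.eq_or_lt with ht | ht
        · rw [← ht]; linarith
        · nlinarith [mul_pos ht (sub_pos.2 h'), mul_nonneg (sub_nonneg.2 t1) (sub_pos.2 h).le]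
      · have h' := (h3 i).1 h
        apply ne_of_gt
        rcases t0.eq_or_lt with ht | ht
        · rw [← ht]; linarith
        · nlinarith [mul_pos ht (sub_pos.2 h'), mul_nonneg (sub_nonneg.2 t1) (sub_pos.2 h).le]
    refine ⟨⟨⟨fun t => ⟨((1 - (t : ℝ)) * z.1.1 + t * w.1.1, (1 - (t : ℝ)) * z.1.2 + t * w.1.2),
      fun i hi => h4 t i (congrArg Prod.fst hi)⟩, by fun_prop⟩, ?_, ?_⟩, ?_⟩
    · apply Subtype.ext; simp
    · apply Subtype.ext; simp
    · intro t
      exact (hmem _).2 (h4 t)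

/-! ## Part 3: the affine configuration space as a punctured plane -/

/-- The planar cross product. -/
def cr (u v : Plane) : ℝ := u 0 * v 1 - u 1 * v 0

/-- Half the difference of the first two points. -/
noncomputable def cfA (p : Fin 4 → Plane) : Plane := fun j => (p 0 j - p 1 j) / 2

/-- Half the difference of the last two points. -/
noncomputable def cfB (p : Fin 4 → Plane) : Plane := fun j => (p 2 j - p 3 j) / 2

/-- The difference of the two midpoints. -/
noncomputable def cfC (p : Fin 4 → Plane) : Plane := fun j => (p 0 j + p 1 j - p 2 j - p 3 j) / 2

noncomputable def cfX (p : Fin 4 → Plane) : ℝ := cr (cfB p) (cfC p)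
noncomputable def cfY (p : Fin 4 → Plane) : ℝ := cr (cfC p) (cfA p)
noncomputable def cfT (p : Fin 4 → Plane) : ℝ := cr (cfA p) (cfB p)

/-- The denominator of the stereographic projection. -/
noncomputable def cfD (p : Fin 4 → Plane) : ℝ :=
  Real.sqrt (cfX p ^ 2 + cfY p ^ 2 + 2 * cfT p ^ 2) - cfX p

theorem cf_scale (g : AffP) (p q : Fin 4 → Plane) (h : ∀ i, g.app (p i) = q i) :
    cfX q = g.A.det * cfX p ∧ cfY q = g.A.det * cfY p ∧ cfT q = g.A.det * cfT p := by
  have h' : ∀ i j, q i j = g.A j 0 * p i 0 + g.A j 1 * p i 1 + g.b j := by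
    intro i j
    rw [← h i]
    have : g.A.mulVec (p i) j = g.A j 0 * p i 0 + g.A j 1 * p i 1 := by
      rw [Matrix.mulVec, dotProduct, Fin.sum_univ_two]
    rw [AffP.app, Pi.add_apply, this]
  simp only [cfX, cfY, cfT, cr, cfA, cfB, cfC, h', Matrix.det_fin_two]
  refine ⟨?_, ?_, ?_⟩ <;> ring

theorem cfD_scale (k : ℝ) (hk : 0 < k) (p q : Fin 4 → Plane)
    (hX : cfX q = k * cfX p) (hY : cfY q = k * cfY p) (hT : cfT q = k * cfT p) :
    cfD q = k * cfD p := by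
  have : cfX q ^ 2 + cfY q ^ 2 + 2 * cfT q ^ 2 =
      k ^ 2 * (cfX p ^ 2 + cfY p ^ 2 + 2 * cfT p ^ 2) := by
    rw [hX, hY, hT]; ring
  unfold cfD
  rw [this, hX, Real.sqrt_mul (sq_nonneg k), Real.sqrt_sq hk.le]
  ring

theorem cf_nondeg (p : SpanConf4) : cfY p.1 ≠ 0 ∨ cfT p.1 ≠ 0 := by
  by_contra! hcon
  obtain ⟨hY, hT⟩ := hcon
  obtain ⟨p, hinj, hspan⟩ := p
  simp only at hY hT
  have key : ∀ x : Plane, cr (cfA p) x = cr (cfA p) (p 0) := by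
    intro x
    have hx : x ∈ affineSpan ℝ (Set.range p) := by rw [hspan]; trivial
    refine affineSpan_induction (p := fun x => cr (cfA p) x = cr (cfA p) (p 0)) hx ?_ ?_
    · rintro _ ⟨i, rfl⟩
      simp only [cfY, cfT, cr, cfA, cfB, cfC] at hY hT ⊢
      fin_cases i
      · rfl
      · simp only [Fin.mk_one]; ring
      · simp only [Fin.reduceFinMk]; linear_combination hY + hT
      · simp only [Fin.reduceFinMk]; linear_combination hY - hT
    · intro c u v w hu hv hw
      simp only [cr, vsub_eq_sub, vadd_eq_add, Pi.add_apply, Pi.smul_apply, Pi.sub_apply,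
        smul_eq_mul] at *
      linear_combination c * (hu - hv) + hw
  have h0 := key 0
  have h1 := key ![1, 0]
  have h2 := key ![0, 1]
  simp only [cr, Pi.zero_apply, Matrix.cons_val_zero, Matrix.cons_val_one] at h0 h1 h2
  have e0 : cfA p 0 = 0 := by linarith
  have e1 : cfA p 1 = 0 := by linarith
  have : p 0 = p 1 := by
    ext j
    simp only [cfA] at e0 e1
    fin_cases j
    · simp only [Fin.zero_eta]; linarith
    · simp only [Fin.mk_one]; linarith
  exact absurd (hinj this) (by decide)

theorem cfD_pos (p : SpanConf4) : 0 < cfD p.1 := by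
  unfold cfD
  rw [sub_pos]
  apply Real.lt_sqrt_of_sq_lt
  rcases cf_nondeg p with h | h
  · nlinarith [sq_nonneg (cfT p.1), pow_pos (abs_pos.2 h) 2, sq_abs (cfY p.1)]
  · nlinarith [sq_nonneg (cfY p.1), pow_pos (abs_pos.2 h) 2, sq_abs (cfT p.1)]

/-- First affine coordinate of a configuration. -/
noncomputable def cfa (p : Fin 4 → Plane) : ℝ := cfY p / cfD p
/-- Second affine coordinate of a configuration. -/
noncomputable def cfb (p : Fin 4 → Plane) : ℝ := cfT p / cfD p

theorem cf_eq (p : SpanConf4) :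
    cfX p.1 = cfD p.1 / 2 * (cfa p.1 ^ 2 + 2 * cfb p.1 ^ 2 - 1) ∧
    cfY p.1 = cfD p.1 / 2 * (2 * cfa p.1) ∧ cfT p.1 = cfD p.1 / 2 * (2 * cfb p.1) := by
  have hd := cfD_pos p
  have hY : cfY p.1 = cfD p.1 * cfa p.1 := by unfold cfa; field_simp
  have hT : cfT p.1 = cfD p.1 * cfb p.1 := by unfold cfb; field_simp
  refine ⟨?_, by rw [hY]; ring, by rw [hT]; ring⟩
  have hR : (cfD p.1 + cfX p.1) ^ 2 = cfX p.1 ^ 2 + cfY p.1 ^ 2 + 2 * cfT p.1 ^ 2 := by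
    unfold cfD
    rw [sub_add_cancel, Real.sq_sqrt (by positivity)]
  rw [hY, hT] at hR
  apply mul_left_cancel₀ hd.ne'
  linear_combination hR / 2

theorem cf_rel (p : SpanConf4) (j : Fin 2) :
    (cfa p.1 ^ 2 + 2 * cfb p.1 ^ 2 - 1) * cfA p.1 j + 2 * cfa p.1 * cfB p.1 j
      + 2 * cfb p.1 * cfC p.1 j = 0 := by
  have hd := cfD_pos p
  obtain ⟨hX, hY, hT⟩ := cf_eq p
  have : cfX p.1 * cfA p.1 j + cfY p.1 * cfB p.1 j + cfT p.1 * cfC p.1 j = 0 := by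
    simp only [cfX, cfY, cfT, cr]
    fin_cases j
    · simp only [Fin.zero_eta]; ring
    · simp only [Fin.mk_one]; ring
  rw [hX, hY, hT] at this
  apply mul_left_cancel₀ (half_pos hd).ne'
  linear_combination this

/-- Sheared first coordinates of the eleven punctures. -/
def pxs : Fin 11 → ℝ := ![-12, -9, -6, -4, -2, 0, 2, 4, 6, 9, 12]
/-- Second coordinates of the eleven punctures. -/
noncomputable def pys : Fin 11 → ℝ :=
  ![-1, 0, 1, -1/3, 1/3, 0, -1/3, 1/3, -1, 0, 1]

theorem cf_avoid (p : SpanConf4) (i : Fin 11) :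
    (9 * cfa p.1 + 3 * cfb p.1, cfb p.1) ≠ (pxs i, pys i) := by
  intro h
  have hb : cfb p.1 = pys i := congrArg Prod.snd h
  have ha : cfa p.1 = (pxs i - 3 * pys i) / 9 := by
    have := congrArg Prod.fst h
    simp only at this
    linarith
  have h0 := cf_rel p 0
  have h1 := cf_rel p 1
  rw [ha, hb] at h0 h1
  simp only [cfA, cfB, cfC] at h0 h1
  have fin : ∀ k l : Fin 4, k ≠ l → p.1 k 0 = p.1 l 0 → p.1 k 1 = p.1 l 1 → False := by
    intro k l hkl e0 e1
    refine hkl (p.2.1 ?_)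
    ext j
    fin_cases j
    · exact e0
    · exact e1
  clear h ha hb
  fin_cases i <;> norm_num [pxs, pys] at h0 h1
  · exact fin 1 3 (by decide) (by linarith) (by linarith)
  · exact fin 2 3 (by decide) (by linarith) (by linarith)
  · exact fin 0 2 (by decide) (by linarith) (by linarith)
  · exact fin 0 3 (by decide) (by linarith) (by linarith)
  · exact fin 1 2 (by decide) (by linarith) (by linarith)
  · exact fin 0 1 (by decide) (by linarith) (by linarith)
  · exact fin 0 2 (by decide) (by linarith) (by linarith)
  · exact fin 1 3 (by decide) (by linarith) (by linarith)
  · exact fin 1 2 (by decide) (by linarith) (by linarith)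
  · exact fin 2 3 (by decide) (by linarith) (by linarith)
  · exact fin 0 3 (by decide) (by linarith) (by linarith)

/-- The normalised configuration with coordinates `a`, `b`. -/
noncomputable def cfMk (a b : ℝ) : Fin 4 → Plane :=
  ![![1 + a ^ 2 - 2 * b ^ 2 + 2 * b, -4 * a * b + 2 * a],
    ![1 + a ^ 2 - 2 * b ^ 2 - 2 * b, -4 * a * b - 2 * a],
    ![-2 * a * b, 1 + 2 * b ^ 2 - a ^ 2],
    ![2 * a * b, -(1 + 2 * b ^ 2 - a ^ 2)]]

theorem cfMk_X (a b : ℝ) :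
    cfX (cfMk a b) = (1 + a ^ 2 + 2 * b ^ 2) * (a ^ 2 + 2 * b ^ 2 - 1) := by
  simp only [cfX, cr, cfB, cfC, cfMk, Matrix.cons_val]
  ring

theorem cfMk_Y (a b : ℝ) : cfY (cfMk a b) = (1 + a ^ 2 + 2 * b ^ 2) * (2 * a) := by
  simp only [cfY, cr, cfA, cfC, cfMk, Matrix.cons_val]
  ring

theorem cfMk_T (a b : ℝ) : cfT (cfMk a b) = (1 + a ^ 2 + 2 * b ^ 2) * (2 * b) := by
  simp only [cfT, cr, cfA, cfB, cfMk, Matrix.cons_val]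
  ring

theorem cfMk_D (a b : ℝ) : cfD (cfMk a b) = 2 * (1 + a ^ 2 + 2 * b ^ 2) := by
  have h : cfX (cfMk a b) ^ 2 + cfY (cfMk a b) ^ 2 + 2 * cfT (cfMk a b) ^ 2 =
      ((1 + a ^ 2 + 2 * b ^ 2) ^ 2) ^ 2 := by
    rw [cfMk_X, cfMk_Y, cfMk_T]; ring
  rw [cfD, h, Real.sqrt_sq (by positivity), cfMk_X]
  ring

theorem cfa_cfMk (a b : ℝ) : cfa (cfMk a b) = a := by
  have : 0 < 1 + a ^ 2 + 2 * b ^ 2 := by positivity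
  rw [cfa, cfMk_D, cfMk_Y]
  field_simp

theorem cfb_cfMk (a b : ℝ) : cfb (cfMk a b) = b := by
  have : 0 < 1 + a ^ 2 + 2 * b ^ 2 := by positivity
  rw [cfb, cfMk_D, cfMk_T]
  field_simp

theorem mem_of_cr_ne {V : Submodule ℝ Plane} {u v : Plane} (hu : u ∈ V) (hv : v ∈ V)
    (h : cr u v ≠ 0) : V = ⊤ := by
  rw [eq_top_iff]
  intro x _
  have : x = (cr x v / cr u v) • u + (cr u x / cr u v) • v := by
    ext j
    simp only [Pi.add_apply, Pi.smul_apply, smul_eq_mul]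
    field_simp
    simp only [cr]
    fin_cases j
    · simp only [Fin.zero_eta]; ring
    · simp only [Fin.mk_one]; ring
  rw [this]
  exact V.add_mem (V.smul_mem _ hu) (V.smul_mem _ hv)

theorem span_of_nondeg (p : Fin 4 → Plane) (h : cfY p ≠ 0 ∨ cfT p ≠ 0) :
    affineSpan ℝ (Set.range p) = ⊤ := by
  rw [AffineSubspace.affineSpan_eq_top_iff_vectorSpan_eq_top_of_nonempty ℝ Plane Plane
    (Set.range_nonempty p)]
  have hm : ∀ i j, p i - p j ∈ vectorSpan ℝ (Set.range p) := fun i j =>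
    vsub_mem_vectorSpan ℝ ⟨i, rfl⟩ ⟨j, rfl⟩
  have hA : cfA p ∈ vectorSpan ℝ (Set.range p) := by
    have : cfA p = (1 / 2 : ℝ) • (p 0 - p 1) := by
      ext j; simp only [cfA, Pi.smul_apply, Pi.sub_apply, smul_eq_mul]; ring
    rw [this]; exact Submodule.smul_mem _ _ (hm _ _)
  have hB : cfB p ∈ vectorSpan ℝ (Set.range p) := by
    have : cfB p = (1 / 2 : ℝ) • (p 2 - p 3) := by
      ext j; simp only [cfB, Pi.smul_apply, Pi.sub_apply, smul_eq_mul]; ring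
    rw [this]; exact Submodule.smul_mem _ _ (hm _ _)
  have hC : cfC p ∈ vectorSpan ℝ (Set.range p) := by
    have : cfC p = (1 / 2 : ℝ) • ((p 0 - p 2) + (p 1 - p 3)) := by
      ext j; simp only [cfC, Pi.smul_apply, Pi.sub_apply, Pi.add_apply, smul_eq_mul]; ring
    rw [this]; exact Submodule.smul_mem _ _ (Submodule.add_mem _ (hm _ _) (hm _ _))
  rcases h with h | h
  · exact mem_of_cr_ne hC hA h
  · exact mem_of_cr_ne hA hB h

/-- Linear algebra: proportional cross products give an orientation preserving linear map. -/
theorem exists_lin (u v w u' v' w' : Plane) (k : ℝ) (hk : 0 < k) (h : cr u v ≠ 0)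
    (h1 : cr u' v' = k * cr u v) (h2 : cr v' w' = k * cr v w) (h3 : cr w' u' = k * cr w u) :
    ∃ A : Matrix (Fin 2) (Fin 2) ℝ, 0 < A.det ∧
      (∀ j, A j 0 * u 0 + A j 1 * u 1 = u' j) ∧ (∀ j, A j 0 * v 0 + A j 1 * v 1 = v' j) ∧
      (∀ j, A j 0 * w 0 + A j 1 * w 1 = w' j) := by
  have hA : ∀ j : Fin 2, ∀ x : Plane, (u' j * v 1 - v' j * u 1) / cr u v * x 0 +
      (v' j * u 0 - u' j * v 0) / cr u v * x 1 = (u' j * cr x v + v' j * cr u x) / cr u v := by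
    intro j x
    simp only [cr]
    ring
  refine ⟨Matrix.of fun j => ![(u' j * v 1 - v' j * u 1) / cr u v,
    (v' j * u 0 - u' j * v 0) / cr u v], ?_, ?_, ?_, ?_⟩
  · have : (Matrix.of fun j => ![(u' j * v 1 - v' j * u 1) / cr u v,
        (v' j * u 0 - u' j * v 0) / cr u v] : Matrix (Fin 2) (Fin 2) ℝ).det = k := by
      simp only [Matrix.det_fin_two, Matrix.of_apply, Matrix.cons_val]
      field_simp
      simp only [cr] at *
      linear_combination (u 0 * v 1 - u 1 * v 0) * h1
    rw [this]; exact hk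
  all_goals
    intro j
    simp only [Matrix.of_apply, Matrix.cons_val]
    rw [hA, div_eq_iff h]
  · simp only [cr]; ring
  · simp only [cr]; ring
  · have hw : cr v' w' * u' j + cr w' u' * v' j + cr u' v' * w' j = 0 := by
      simp only [cr]
      fin_cases j
      · simp only [Fin.zero_eta]; ring
      · simp only [Fin.mk_one]; ring
    rw [h1, h2, h3] at hw
    apply mul_left_cancel₀ hk.ne'
    have e1 : cr w v = - cr v w := by simp only [cr]; ring
    have e2 : cr u w = - cr w u := by simp only [cr]; ring
    rw [e1, e2]
    linear_combination -hw

theorem affRel4_of_cr (p q : SpanConf4) (k : ℝ) (hk : 0 < k) (hX : cfX q.1 = k * cfX p.1)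
    (hY : cfY q.1 = k * cfY p.1) (hT : cfT q.1 = k * cfT p.1) : affRel4 p q := by
  obtain ⟨A, hdet, hA, hB, hC⟩ : ∃ A : Matrix (Fin 2) (Fin 2) ℝ, 0 < A.det ∧
      (∀ j, A j 0 * cfA p.1 0 + A j 1 * cfA p.1 1 = cfA q.1 j) ∧
      (∀ j, A j 0 * cfB p.1 0 + A j 1 * cfB p.1 1 = cfB q.1 j) ∧
      (∀ j, A j 0 * cfC p.1 0 + A j 1 * cfC p.1 1 = cfC q.1 j) := by
    rcases cf_nondeg p with h | h
    · obtain ⟨A, h0, h1, h2, h3⟩ := exists_lin _ _ _ _ _ _ k hk h hY hT hX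
      exact ⟨A, h0, h2, h3, h1⟩
    · obtain ⟨A, h0, h1, h2, h3⟩ := exists_lin _ _ _ _ _ _ k hk h hT hX hY
      exact ⟨A, h0, h1, h2, h3⟩
  have hmul : ∀ (x : Plane) j, A.mulVec x j = A j 0 * x 0 + A j 1 * x 1 := by
    intro x j
    rw [Matrix.mulVec, dotProduct, Fin.sum_univ_two]
  refine ⟨⟨A, q.1 0 - A.mulVec (p.1 0), hdet⟩, fun i => ?_⟩
  ext j
  change A.mulVec (p.1 i) j + (q.1 0 j - A.mulVec (p.1 0) j) = q.1 i j
  rw [hmul, hmul]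
  have a := hA j
  have b := hB j
  have c := hC j
  simp only [cfA, cfB, cfC] at a b c
  fin_cases i
  · simp only [Fin.zero_eta]; ring
  · simp only [Fin.mk_one]; linear_combination -2 * a
  · simp only [Fin.reduceFinMk]; linear_combination - a + b - c
  · simp only [Fin.reduceFinMk]; linear_combination - a - b - c

theorem cfMk_inj (x y : ℝ) (h : ∀ i, (x, y) ≠ (pxs i, pys i)) :
    Function.Injective (cfMk ((x - 3 * y) / 9) y) := by
  obtain ⟨a, ha⟩ : ∃ a, a = (x - 3 * y) / 9 := ⟨_, rfl⟩
  rw [← ha]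
  have hx : x = 9 * a + 3 * y := by rw [ha]; ring
  subst hx
  have hs : 1 + a ^ 2 + 2 * y ^ 2 ≠ 0 := by positivity
  have ex : ∀ i, 9 * a + 3 * y = pxs i → y = pys i → False := fun i h1 h2 =>
    h i (Prod.ext h1 h2)
  have e0 : a = 0 → y = 0 → False := fun h1 h2 =>
    ex 5 (by simp only [pxs, Matrix.cons_val]; linarith) (by simp only [pys, Matrix.cons_val]; linarith)
  have e1 : a = 1 → y = 0 → False := fun h1 h2 =>
    ex 9 (by simp only [pxs, Matrix.cons_val]; linarith) (by simp only [pys, Matrix.cons_val]; linarith)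
  have e2 : a = -1 → y = 0 → False := fun h1 h2 =>
    ex 1 (by simp only [pxs, Matrix.cons_val]; linarith) (by simp only [pys, Matrix.cons_val]; linarith)
  have quad : ∀ ε δ : ℝ, (ε = 1 ∨ ε = -1) → (δ = 1 ∨ δ = -1) →
      2 * a = ε * (a ^ 2 + 2 * y ^ 2 - 1) → 2 * y = δ * (a ^ 2 + 2 * y ^ 2 - 1) → False := by
    intro ε δ hε hδ h1 h2
    have hd2 : δ ^ 2 = 1 := by rcases hδ with rfl | rfl <;> norm_num
    have he2 : ε ^ 2 = 1 := by rcases hε with rfl | rfl <;> norm_num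
    obtain ⟨s, hs'⟩ : ∃ s, s = a ^ 2 + 2 * y ^ 2 := ⟨_, rfl⟩
    rw [← hs'] at h1 h2
    have ha' : a = ε * (s - 1) / 2 := by linarith
    have hy' : y = δ * (s - 1) / 2 := by linarith
    have h3 : (s - 3) * (3 * s - 1) = 0 := by
      rw [ha', hy'] at hs'
      linear_combination -4 * hs' - (s - 1) ^ 2 * he2 - 2 * (s - 1) ^ 2 * hd2
    rcases mul_eq_zero.1 h3 with h4 | h4
    · have hs3 : s = 3 := by linarith
      rw [hs3] at ha' hy'
      rcases hε with rfl | rfl <;> rcases hδ with rfl | rfl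
      · exact ex 10 (by simp only [pxs, Matrix.cons_val]; linarith) (by simp only [pys, Matrix.cons_val]; linarith)
      · exact ex 8 (by simp only [pxs, Matrix.cons_val]; linarith) (by simp only [pys, Matrix.cons_val]; linarith)
      · exact ex 2 (by simp only [pxs, Matrix.cons_val]; linarith) (by simp only [pys, Matrix.cons_val]; linarith)
      · exact ex 0 (by simp only [pxs, Matrix.cons_val]; linarith) (by simp only [pys, Matrix.cons_val]; linarith)
    · have hs3 : s = 1 / 3 := by linarith
      rw [hs3] at ha' hy'
      rcases hε with rfl | rfl <;> rcases hδ with rfl | rfl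
      · exact ex 3 (by simp only [pxs, Matrix.cons_val]; linarith) (by simp only [pys, Matrix.cons_val]; linarith)
      · exact ex 4 (by simp only [pxs, Matrix.cons_val]; linarith) (by simp only [pys, Matrix.cons_val]; linarith)
      · exact ex 6 (by simp only [pxs, Matrix.cons_val]; linarith) (by simp only [pys, Matrix.cons_val]; linarith)
      · exact ex 7 (by simp only [pxs, Matrix.cons_val]; linarith) (by simp only [pys, Matrix.cons_val]; linarith)
  have lift : ∀ u v : ℝ, (1 + a ^ 2 + 2 * y ^ 2) * u = (1 + a ^ 2 + 2 * y ^ 2) * v → u = v :=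
    fun u v => mul_left_cancel₀ hs
  have n01 : cfMk a y 0 ≠ cfMk a y 1 := by
    intro h
    have h0 := congrFun h 0
    have h1 := congrFun h 1
    simp only [cfMk, Matrix.cons_val] at h0 h1
    exact e0 (by linarith) (by linarith)
  have n23 : cfMk a y 2 ≠ cfMk a y 3 := by
    intro h
    have h0 := congrFun h 0
    have h1 := congrFun h 1
    simp only [cfMk, Matrix.cons_val] at h0 h1
    have h2 : a * y = 0 := by linarith
    rcases mul_eq_zero.1 h2 with h3 | h3
    · subst h3; nlinarith [sq_nonneg y]
    · have : (a - 1) * (a + 1) = 0 := by rw [h3] at h1; linarith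
      rcases mul_eq_zero.1 this with h4 | h4
      · exact e1 (by linarith) h3
      · exact e2 (by linarith) h3
  have n02 : cfMk a y 0 ≠ cfMk a y 2 := by
    intro h
    have h0 := congrFun h 0
    have h1 := congrFun h 1
    simp only [cfMk, Matrix.cons_val] at h0 h1
    refine quad (-1) (1) (Or.inr rfl) (Or.inl rfl) (lift _ _ ?_) (lift _ _ ?_)
    · linear_combination ((1 + a ^ 2 - 2 * y ^ 2) * h1 + 4 * a * y * h0)
    · linear_combination ((1 + 2 * y ^ 2 - a ^ 2) * h0 + 2 * a * y * h1)
  have n03 : cfMk a y 0 ≠ cfMk a y 3 := by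
    intro h
    have h0 := congrFun h 0
    have h1 := congrFun h 1
    simp only [cfMk, Matrix.cons_val] at h0 h1
    refine quad (1) (1) (Or.inl rfl) (Or.inl rfl) (lift _ _ ?_) (lift _ _ ?_)
    · linear_combination ((1 + a ^ 2 - 2 * y ^ 2) * h1 + 4 * a * y * h0)
    · linear_combination ((1 + 2 * y ^ 2 - a ^ 2) * h0 + 2 * a * y * h1)
  have n12 : cfMk a y 1 ≠ cfMk a y 2 := by
    intro h
    have h0 := congrFun h 0
    have h1 := congrFun h 1
    simp only [cfMk, Matrix.cons_val] at h0 h1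
    refine quad (1) (-1) (Or.inl rfl) (Or.inr rfl) (lift _ _ ?_) (lift _ _ ?_)
    · linear_combination -((1 + a ^ 2 - 2 * y ^ 2) * h1 + 4 * a * y * h0)
    · linear_combination -((1 + 2 * y ^ 2 - a ^ 2) * h0 + 2 * a * y * h1)
  have n13 : cfMk a y 1 ≠ cfMk a y 3 := by
    intro h
    have h0 := congrFun h 0
    have h1 := congrFun h 1
    simp only [cfMk, Matrix.cons_val] at h0 h1
    refine quad (-1) (-1) (Or.inr rfl) (Or.inr rfl) (lift _ _ ?_) (lift _ _ ?_)
    · linear_combination -((1 + a ^ 2 - 2 * y ^ 2) * h1 + 4 * a * y * h0)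
    · linear_combination -((1 + 2 * y ^ 2 - a ^ 2) * h0 + 2 * a * y * h1)
  intro i j hij
  fin_cases i <;> fin_cases j <;> first
    | rfl
    | exact absurd hij n01
    | exact absurd hij n01.symm
    | exact absurd hij n02
    | exact absurd hij n02.symm
    | exact absurd hij n03
    | exact absurd hij n03.symm
    | exact absurd hij n12
    | exact absurd hij n12.symm
    | exact absurd hij n13
    | exact absurd hij n13.symm
    | exact absurd hij n23
    | exact absurd hij n23.symm
theorem pi1_homeo {X Y : Type} [TopologicalSpace X] [TopologicalSpace Y] (h : X ≃ₜ Y) (x : X) :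
    Nonempty (FundamentalGroup X x ≃* FundamentalGroup Y (h x)) := by
  let E := FundamentalGroupoidFunctor.equivOfHomotopyEquiv (X := TopCat.of X) (Y := TopCat.of Y) h.toHomotopyEquiv
  exact ⟨E.fullyFaithfulFunctor.mulEquivEnd (FundamentalGroupoid.mk x)⟩

/-- The section from the punctured plane to configurations. -/
noncomputable def cfSection (z : PPlane pxs pys) : SpanConf4 :=
  ⟨cfMk ((z.1.1 - 3 * z.1.2) / 9) z.1.2, cfMk_inj _ _ z.2, by
    apply span_of_nondeg
    by_contra! hcon
    obtain ⟨h1, h2⟩ := hcon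
    have hs : 1 + ((z.1.1 - 3 * z.1.2) / 9) ^ 2 + 2 * z.1.2 ^ 2 ≠ 0 := by positivity
    rw [cfMk_Y, mul_eq_zero, or_iff_right hs] at h1
    rw [cfMk_T, mul_eq_zero, or_iff_right hs] at h2
    refine z.2 5 (Prod.ext ?_ ?_)
    · simp only [pxs, Matrix.cons_val]; linarith
    · simp only [pys, Matrix.cons_val]; linarith⟩

/-- The coordinate map from configurations to the punctured plane. -/
noncomputable def cfCoord (p : SpanConf4) : PPlane pxs pys :=
  ⟨(9 * cfa p.1 + 3 * cfb p.1, cfb p.1), cf_avoid p⟩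

theorem cfCoord_inv (p q : SpanConf4) (h : affRel4 p q) : cfCoord p = cfCoord q := by
  obtain ⟨g, hg⟩ := h
  obtain ⟨hX, hY, hT⟩ := cf_scale g _ _ hg
  have hD := cfD_scale _ g.det_pos _ _ hX hY hT
  have ha : cfa q.1 = cfa p.1 := by
    rw [cfa, cfa, hY, hD, mul_div_mul_left _ _ g.det_pos.ne']
  have hb : cfb q.1 = cfb p.1 := by
    rw [cfb, cfb, hT, hD, mul_div_mul_left _ _ g.det_pos.ne']
  simp only [cfCoord, ha, hb]

theorem cfSection_continuous : Continuous cfSection := by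
  refine Continuous.subtype_mk ?_ _
  refine continuous_pi fun i => continuous_pi fun j => ?_
  fin_cases i <;> fin_cases j <;>
    simp only [cfMk, Fin.zero_eta, Fin.mk_one, Fin.reduceFinMk, Matrix.cons_val] <;> fun_prop

theorem cfCoord_continuous : Continuous cfCoord := by
  have hX0 : Continuous fun p : Fin 4 → Plane => cfX p := by
    simp only [cfX, cr, cfB, cfC]; fun_prop
  have hX : Continuous fun p : SpanConf4 => cfX p.1 := hX0.comp continuous_subtype_val
  have hY0 : Continuous fun p : Fin 4 → Plane => cfY p := by
    simp only [cfY, cr, cfA, cfC]; fun_prop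
  have hY : Continuous fun p : SpanConf4 => cfY p.1 := hY0.comp continuous_subtype_val
  have hT0 : Continuous fun p : Fin 4 → Plane => cfT p := by
    simp only [cfT, cr, cfA, cfB]; fun_prop
  have hT : Continuous fun p : SpanConf4 => cfT p.1 := hT0.comp continuous_subtype_val
  have hD : Continuous fun p : SpanConf4 => cfD p.1 := by
    simp only [cfD]; fun_prop
  have ha : Continuous fun p : SpanConf4 => cfa p.1 := hY.div hD fun p => (cfD_pos p).ne'
  have hb : Continuous fun p : SpanConf4 => cfb p.1 := hT.div hD fun p => (cfD_pos p).ne'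
  refine Continuous.subtype_mk ?_ _
  fun_prop

theorem cfCoord_cfSection (z : PPlane pxs pys) : cfCoord (cfSection z) = z := by
  apply Subtype.ext
  simp only [cfCoord, cfSection, cfa_cfMk, cfb_cfMk]
  refine Prod.ext ?_ rfl
  simp only
  ring

theorem cfSection_cfCoord (p : SpanConf4) : affRel4 (cfSection (cfCoord p)) p := by
  have hd := cfD_pos p
  have e : (cfSection (cfCoord p)).1 = cfMk (cfa p.1) (cfb p.1) := by
    simp only [cfSection, cfCoord]
    congr 1
    ring
  have hs : 0 < 1 + cfa p.1 ^ 2 + 2 * cfb p.1 ^ 2 := by positivity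
  obtain ⟨hX, hY, hT⟩ := cf_eq p
  refine affRel4_of_cr _ _ (cfD p.1 / 2 / (1 + cfa p.1 ^ 2 + 2 * cfb p.1 ^ 2)) (by positivity)
    ?_ ?_ ?_
  · rw [e, cfMk_X]
    refine hX.trans ?_
    field_simp
  · rw [e, cfMk_Y]
    refine hY.trans ?_
    field_simp
  · rw [e, cfMk_T]
    refine hT.trans ?_
    field_simp

/-- The configuration space is homeomorphic to the plane with eleven punctures. -/
noncomputable def affConf4Homeo : AffConf4 ≃ₜ PPlane pxs pys where
  toFun := Quot.lift cfCoord cfCoord_inv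
  invFun z := Quot.mk _ (cfSection z)
  left_inv := by
    rintro ⟨p⟩
    exact Quot.sound (cfSection_cfCoord p)
  right_inv := cfCoord_cfSection
  continuous_toFun := continuous_quot_lift _ cfCoord_continuous
  continuous_invFun := continuous_quot_mk.comp cfSection_continuous

theorem pxs_pi1 (x : PPlane pxs pys) :
    Nonempty (FundamentalGroup (PPlane pxs pys) x ≃* FreeGroup (Fin 11)) := by
  have ha : ∀ i, pxs i = ((![-12, -9, -6, -4, -2, 0, 2, 4, 6, 9, 12] : Fin 11 → ℤ) i : ℝ) := by
    intro i
    fin_cases i <;> simp [pxs]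
  refine punctured_pi1 pxs pys (fun k =>
    ((![-13, -10, -7, -5, -3, -1, 1, 3, 5, 7, 10, 13] : Fin 12 → ℤ) k : ℝ)) ?_ ?_ x
  · intro k i
    rw [ha, Int.cast_lt]
    revert k i
    decide
  · intro k i
    rw [ha, Ne, Int.cast_inj]
    revert k i
    decide

/-- The fundamental group of `A 4` is isomorphic to the free group on 11 generators. -/
theorem fundamentalGroup_affConf4_free_eleven :
    ∀ a : AffConf4,
      Nonempty (FundamentalGroup AffConf4 a ≃* FreeGroup (Fin 11)) := by
  intro a
  obtain ⟨e⟩ := pi1_homeo affConf4Homeo a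
  obtain ⟨f⟩ := pxs_pi1 (affConf4Homeo a)
  exact ⟨e.trans f⟩
end
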